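/- arXiv:2305.15493 — 3 statements merged into one kernel-verified Lean document; each statement's English description precedes it below -/
import Mathlib

section
/- Let f ∈ ℤ[X] be a polynomial of degree k with content 1. Then for every square-free positive integer q and every ε > 0, ρ_f(q²) ≪_ε q^ε · gcd(Δ_f, q), where the implied constant depends only on k and ε. -/
open Polynomial

/-- Number of roots of `f` modulo `m`. -/
def rho (f : Polynomial ℤ) (m : ℕ) : ℕ :=
  ((Finset.range m).filter (fun n : ℕ => (m : ℤ) ∣ f.eval (n : ℤ))).card

/-- The discriminant of an integer polynomial, computed via its complex roots:
`Δ_f = lc^(2k-2) ∏_{i<j} (α_i - α_j)^2 = (-1)^{k(k-1)/2} lc^(2k-2) ∏_{i≠j} (α_i - α_j)`. -/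
noncomputable def disc (f : Polynomial ℤ) : ℂ :=
  (-1) ^ (f.natDegree * (f.natDegree - 1) / 2) *
    (f.leadingCoeff : ℂ) ^ (2 * f.natDegree - 2) *
      ∏ p ∈ (Finset.univ :
          Finset (Fin ((f.map (Int.castRingHom ℂ)).roots.toList.length))).offDiag,
        ((f.map (Int.castRingHom ℂ)).roots.toList.get p.1 -
          (f.map (Int.castRingHom ℂ)).roots.toList.get p.2)

namespace Polynomial

theorem sum_pow_mul_sylvester_castAdd {R : Type*} [CommRing R] {f g : R[X]} {m n : ℕ}
    (hg : g.natDegree ≤ n) (x : R) (j : Fin m) :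
    ∑ i : Fin (m + n), x ^ (i : ℕ) * sylvester f g m n i (Fin.castAdd n j) =
      x ^ (j : ℕ) * g.eval x := by
  have hdeg : (X ^ (j : ℕ) * g).natDegree < m + n := by
    have h₁ := natDegree_X_pow_le (R := R) (j : ℕ)
    have h₂ := natDegree_mul_le (p := X ^ (j : ℕ)) (q := g)
    have := j.isLt
    lia
  have h := eval_eq_sum_range' hdeg x
  rw [eval_mul, eval_pow, eval_X] at h
  rw [h, Finset.sum_range]
  refine Finset.sum_congr rfl fun i _ ↦ ?_
  rw [mul_comm, coeff_X_pow_mul', sylvester, Matrix.of_apply, Fin.addCases_left]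
  congr 1
  by_cases h₁ : (j : ℕ) ≤ i
  · by_cases h₂ : (i : ℕ) ≤ j + n
    · simp [h₁, h₂]
    · rw [if_neg (by simp [h₂]), if_pos h₁, coeff_eq_zero_of_natDegree_lt (by lia)]
  · simp [h₁]

theorem sum_pow_mul_sylvester_natAdd {R : Type*} [CommRing R] {f g : R[X]} {m n : ℕ}
    (hf : f.natDegree ≤ m) (x : R) (j : Fin n) :
    ∑ i : Fin (m + n), x ^ (i : ℕ) * sylvester f g m n i (Fin.natAdd m j) =
      x ^ (j : ℕ) * f.eval x := by
  have hdeg : (X ^ (j : ℕ) * f).natDegree < m + n := by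
    have h₁ := natDegree_X_pow_le (R := R) (j : ℕ)
    have h₂ := natDegree_mul_le (p := X ^ (j : ℕ)) (q := f)
    have := j.isLt
    lia
  have h := eval_eq_sum_range' hdeg x
  rw [eval_mul, eval_pow, eval_X] at h
  rw [h, Finset.sum_range]
  refine Finset.sum_congr rfl fun i _ ↦ ?_
  rw [mul_comm, coeff_X_pow_mul', sylvester, Matrix.of_apply, Fin.addCases_right]
  congr 1
  by_cases h₁ : (j : ℕ) ≤ i
  · by_cases h₂ : (i : ℕ) ≤ j + m
    · simp [h₁, h₂]
    · rw [if_neg (by simp [h₂]), if_pos h₁, coeff_eq_zero_of_natDegree_lt (by lia)]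
  · simp [h₁]

/-- A prime dividing the values at some point of both `f` and its derivative divides the
discriminant of `f`, even if it divides the leading coefficient. -/
theorem dvd_discr_of_dvd_eval {f : ℤ[X]} (hf : 2 ≤ f.natDegree) {p : ℕ} [Fact p.Prime] {x : ℤ}
    (h : (p : ℤ) ∣ f.eval x) (h' : (p : ℤ) ∣ f.derivative.eval x) : (p : ℤ) ∣ f.discr := by
  set l : Fin (f.natDegree - 1 + f.natDegree) := ⟨2 * f.natDegree - 2, by lia⟩ with hl
  let v : Fin (f.natDegree - 1 + f.natDegree) → ℤ := fun i ↦
    if i = l then f.leadingCoeff * x ^ (i : ℕ) else x ^ (i : ℕ)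
  have hv (j) : (p : ℤ) ∣ ∑ i, v i * f.sylvesterDeriv i j := by
    have hS (i) : v i * f.sylvesterDeriv i j =
        x ^ (i : ℕ) * f.derivative.sylvester f (f.natDegree - 1) f.natDegree i j := by
      rw [← sylvesterDeriv_updateRow f (by lia), ← hl]
      by_cases hi : i = l
      · subst hi
        simp [v]
        ring
      · simp [v, hi]
    rw [Finset.sum_congr rfl fun i _ ↦ hS i]
    induction j using Fin.addCases with
    | left j => rw [sum_pow_mul_sylvester_castAdd le_rfl]; exact h.mul_left _
    | right j =>
      rw [sum_pow_mul_sylvester_natAdd (natDegree_derivative_le f)]; exact h'.mul_left _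
  have hdet : ((f.sylvesterDeriv.map (Int.castRingHom (ZMod p))).det) = 0 := by
    refine Matrix.exists_vecMul_eq_zero_iff.mp ⟨fun i ↦ (v i : ZMod p), ?_, ?_⟩
    · refine fun h0 ↦ one_ne_zero (α := ZMod p) ?_
      have h₀ := congrFun h0 ⟨0, by lia⟩
      have hne : (⟨0, by lia⟩ : Fin (f.natDegree - 1 + f.natDegree)) ≠ l := by
        rw [hl, Ne, Fin.mk.injEq]; lia
      simp [v, hne] at h₀
    · ext j
      have := (ZMod.intCast_zmod_eq_zero_iff_dvd _ p).mpr (hv j)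
      push_cast at this
      simpa [Matrix.vecMul, dotProduct] using this
  rw [← RingHom.mapMatrix_apply, ← RingHom.map_det] at hdet
  rw [discr]
  exact ((ZMod.intCast_zmod_eq_zero_iff_dvd _ p).mp hdet).mul_right _

end Polynomial

theorem disc_eq_discr {f : ℤ[X]} (hf : 0 < f.natDegree) : disc f = (f.discr : ℂ) := by
  have hinj : Function.Injective (Int.castRingHom ℂ) := Int.cast_injective
  have hlc : (f.leadingCoeff : ℂ) ≠ 0 := by
    have : f ≠ 0 := by rintro rfl; simp at hf
    exact_mod_cast leadingCoeff_ne_zero.mpr this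
  set F := f.map (Int.castRingHom ℂ) with hF
  set L := F.roots.toList with hL
  have hFdeg : F.natDegree = f.natDegree := natDegree_map_eq_of_injective hinj f
  have hFlc : F.leadingCoeff = f.leadingCoeff := leadingCoeff_map_of_injective hinj f
  have hsplit : F.Splits := IsAlgClosed.splits F
  have hroots : F.roots = (Finset.univ : Finset (Fin L.length)).val.map L.get := by
    have : F.roots = (L : Multiset ℂ) := (Multiset.coe_toList _).symm
    rw [this, Fin.univ_val_map, List.ofFn_get]
  have hcard : L.length = f.natDegree := by
    rw [hL, Multiset.length_toList, ← hsplit.natDegree_eq_card_roots, hFdeg]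
  have hfac : F = C (f.leadingCoeff : ℂ) * ∏ i, (X - C (L.get i)) := by
    conv_lhs => rw [hsplit.eq_prod_roots, hFlc, hroots, Multiset.map_map]
    rfl
  have hder (i) : F.derivative.eval (L.get i) =
      f.leadingCoeff * ∏ j ∈ Finset.univ.erase i, (L.get i - L.get j) := by
    rw [hfac, derivative_C_mul, derivative_prod_finset, eval_mul, eval_C, eval_finsetSum,
      Finset.sum_eq_single i]
    · simp [eval_prod]
    · intro b _ hb
      rw [eval_mul, eval_prod, Finset.prod_eq_zero (i := i) (by simp [hb.symm]) (by simp), zero_mul]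
    · simp
  have hoff : ∏ p ∈ (Finset.univ : Finset (Fin L.length)).offDiag, (L.get p.1 - L.get p.2) =
      ∏ i, ∏ j ∈ Finset.univ.erase i, (L.get i - L.get j) :=
    Finset.prod_finset_product' _ _ _ (by simp [eq_comm]) (f := fun i j ↦ L.get i - L.get j)
  have hres := resultant_eq_prod_eval F F.derivative (f.natDegree - 1)
    (hFdeg ▸ natDegree_derivative_le F) hsplit
  have hres' := congrArg (Int.castRingHom ℂ) (resultant_deriv (natDegree_pos_iff_degree_pos.mp hf))
  rw [← resultant_map_map, ← derivative_map, ← hF] at hres'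
  rw [hFdeg] at hres
  have hprod : (F.roots.map F.derivative.eval).prod =
      (f.leadingCoeff : ℂ) ^ f.natDegree *
        ∏ i, ∏ j ∈ Finset.univ.erase i, (L.get i - L.get j) := by
    rw [hroots, Multiset.map_map]
    change ∏ i, F.derivative.eval (L.get i) = _
    rw [Finset.prod_congr rfl fun i _ ↦ hder i, Finset.prod_mul_distrib]
    simp [hcard]
  rw [hprod, hFlc, hres'] at hres
  rw [disc, ← hF, ← hL, hoff]
  generalize (∏ i, ∏ j ∈ Finset.univ.erase i, (L.get i - L.get j)) = P at *
  simp only [eq_intCast, Int.cast_mul, Int.cast_pow, Int.cast_neg, Int.cast_one] at hres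
  obtain ⟨n, hn⟩ : ∃ n, f.natDegree = n + 1 := ⟨f.natDegree - 1, by lia⟩
  have hsign : ((-1 : ℂ) ^ (f.natDegree * (f.natDegree - 1) / 2)) ^ 2 = 1 := by
    rw [← pow_mul, mul_comm, pow_mul]; simp
  generalize ((-1 : ℂ) ^ (f.natDegree * (f.natDegree - 1) / 2)) = s at *
  refine mul_left_cancel₀ hlc ?_
  have e₁ : 2 * f.natDegree - 2 = 2 * n := by lia
  rw [e₁]
  rw [hn, Nat.add_sub_cancel] at hres
  linear_combination (-s) * hres + (f.leadingCoeff * (f.discr : ℂ)) * hsign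

theorem dvd_eval_mod_iff (f : ℤ[X]) {d m : ℕ} (h : d ∣ m) (n : ℕ) :
    (d : ℤ) ∣ f.eval ((n % m : ℕ) : ℤ) ↔ (d : ℤ) ∣ f.eval (n : ℤ) := by
  have hmod : (m : ℤ) ∣ (n : ℤ) - ((n % m : ℕ) : ℤ) := by
    push_cast
    exact Int.dvd_self_sub_emod
  have hdvd : (d : ℤ) ∣ f.eval (n : ℤ) - f.eval ((n % m : ℕ) : ℤ) :=
    ((Int.natCast_dvd_natCast.mpr h).trans hmod).trans (sub_dvd_eval_sub _ _ f)
  exact (dvd_iff_dvd_of_dvd_sub hdvd).symm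

theorem rho_mul_le (f : ℤ[X]) {a b : ℕ} (ha : 0 < a) (hb : 0 < b) (hab : a.Coprime b) :
    rho f (a * b) ≤ rho f a * rho f b := by
  rw [rho, rho, rho, ← Finset.card_product]
  refine Finset.card_le_card_of_injOn (fun n ↦ (n % a, n % b)) ?_ ?_
  · intro n hn
    simp only [Finset.coe_filter, Finset.mem_range, Set.mem_ofPred_eq] at hn
    simp only [Finset.coe_product, Finset.coe_filter, Finset.mem_range, Set.mem_prod,
      Set.mem_ofPred_eq, dvd_eval_mod_iff f dvd_rfl]
    have h := hn.2
    push_cast at h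
    exact ⟨⟨Nat.mod_lt _ ha, (dvd_mul_right _ _).trans h⟩,
      ⟨Nat.mod_lt _ hb, (dvd_mul_left _ _).trans h⟩⟩
  · intro n hn n' hn' h
    simp only [Finset.coe_filter, Finset.mem_range, Set.mem_ofPred_eq] at hn hn'
    rw [Prod.mk.injEq] at h
    exact Nat.ModEq.eq_of_lt_of_lt ((Nat.modEq_and_modEq_iff_modEq_mul hab).mp h) hn.1 hn'.1

theorem rho_prime_le_natDegree {f : ℤ[X]} (hf : f.content = 1) {p : ℕ} (hp : p.Prime) :
    rho f p ≤ f.natDegree := by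
  have : Fact p.Prime := ⟨hp⟩
  have hne : f.map (Int.castRingHom (ZMod p)) ≠ 0 := by
    intro h0
    have hdvd : (p : ℤ) ∣ f.content := dvd_content_iff_C_dvd.mpr <| C_dvd_iff_dvd_coeff _ _ |>.mpr
      fun i ↦ (ZMod.intCast_zmod_eq_zero_iff_dvd _ p).mp (by simpa using congrArg (coeff · i) h0)
    rw [hf] at hdvd
    exact hp.one_lt.ne' (by exact_mod_cast Int.eq_one_of_dvd_one (by positivity) hdvd)
  have hcard : rho f p ≤ (f.map (Int.castRingHom (ZMod p))).roots.toFinset.card := by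
    refine Finset.card_le_card_of_injOn (fun n ↦ (n : ZMod p)) ?_ ?_
    · intro n hn
      simp only [Finset.coe_filter, Finset.mem_range, Set.mem_ofPred_eq] at hn
      have h := (ZMod.intCast_zmod_eq_zero_iff_dvd _ p).mpr hn.2
      simp only [Finset.mem_coe, Multiset.mem_toFinset, mem_roots hne, IsRoot.def]
      rw [← Int.cast_natCast (R := ZMod p) n, ← eq_intCast (Int.castRingHom (ZMod p)) (n : ℤ),
        eval_map_apply]
      simpa using h
    · intro n hn n' hn' h
      simp only [Finset.coe_filter, Finset.mem_range, Set.mem_ofPred_eq] at hn hn'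
      exact Nat.ModEq.eq_of_lt_of_lt ((ZMod.natCast_eq_natCast_iff _ _ _).mp h) hn.1 hn'.1
  exact hcard.trans <| (Multiset.toFinset_card_le _).trans <| (card_roots' _).trans natDegree_map_le

theorem rho_sq_le_mul_rho (f : ℤ[X]) {p N : ℕ} (hp : 0 < p)
    (hN : ∀ r : ℕ, (p : ℤ) ∣ f.eval (r : ℤ) →
      ((Finset.range (p ^ 2)).filter fun n : ℕ ↦
        ((p ^ 2 : ℕ) : ℤ) ∣ f.eval (n : ℤ) ∧ n % p = r).card ≤ N) :
    rho f (p ^ 2) ≤ N * rho f p := by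
  refine Finset.card_le_mul_card_image_of_maps_to (f := (· % p)) ?_ N ?_
  · intro n hn
    simp only [Finset.mem_filter, Finset.mem_range] at hn ⊢
    exact ⟨Nat.mod_lt _ hp, (dvd_eval_mod_iff f dvd_rfl n).mpr <|
      (Int.natCast_dvd_natCast.mpr (dvd_pow_self p two_ne_zero)).trans hn.2⟩
  · intro r hr
    rw [Finset.filter_filter]
    exact hN r (Finset.mem_filter.mp hr).2

theorem rho_prime_sq_le {f : ℤ[X]} (hdeg : 1 ≤ f.natDegree) (hf : f.content = 1) {D : ℤ}
    (hD : (D : ℂ) = disc f) {p : ℕ} (hp : p.Prime) :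
    rho f (p ^ 2) ≤ f.natDegree * Int.gcd D p := by
  have : Fact p.Prime := ⟨hp⟩
  have hD' : D = f.discr := by
    rw [disc_eq_discr hdeg] at hD
    exact_mod_cast hD
  suffices h : rho f (p ^ 2) ≤ Int.gcd D p * rho f p by
    rw [mul_comm]
    exact h.trans (Nat.mul_le_mul_left _ (rho_prime_le_natDegree hf hp))
  refine rho_sq_le_mul_rho f hp.pos fun r hr ↦ ?_
  by_cases hpD : (p : ℤ) ∣ D
  · rw [Int.gcd_eq_natAbs_right hpD, Int.natAbs_natCast]
    calc _ ≤ (Finset.range p).card := by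
          refine Finset.card_le_card_of_injOn (· / p) ?_ ?_
          · intro n hn
            simp only [Finset.coe_filter, Finset.mem_range, Set.mem_ofPred_eq] at hn
            simp only [Finset.coe_range, Set.mem_Iio]
            exact Nat.div_lt_of_lt_mul (by rw [← sq]; exact hn.1)
          · intro n hn n' hn' h
            simp only [Finset.coe_filter, Finset.mem_range, Set.mem_ofPred_eq] at hn hn' h
            rw [← Nat.div_add_mod n p, ← Nat.div_add_mod n' p, h, hn.2.2, hn'.2.2]
      _ = p := Finset.card_range p
  · have hder (n : ℤ) (hn : (p : ℤ) ∣ f.eval n) : ¬ (p : ℤ) ∣ f.derivative.eval n := by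
      intro h'
      rcases hdeg.eq_or_lt with h1 | h2
      · rw [eq_X_add_C_of_natDegree_le_one h1.ge] at hn h'
        simp only [derivative_add, derivative_C_mul_X, derivative_C, add_zero, eval_C, eval_add,
          eval_mul, eval_X] at hn h'
        have h0 : (p : ℤ) ∣ f.coeff 0 := (dvd_add_right (h'.mul_right n)).mp hn
        have hdvd : (p : ℤ) ∣ f.content := by
          refine dvd_content_iff_C_dvd.mpr <| (C_dvd_iff_dvd_coeff _ _).mpr fun i ↦ ?_
          match i with
          | 0 => exact h0
          | 1 => exact h'
          | i + 2 => rw [coeff_eq_zero_of_natDegree_lt (by lia)]; exact dvd_zero _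
        rw [hf] at hdvd
        exact hp.one_lt.ne' (by exact_mod_cast Int.eq_one_of_dvd_one (by positivity) hdvd)
      · exact hpD (hD' ▸ dvd_discr_of_dvd_eval h2 hn h')
    refine le_trans ?_ (Nat.one_le_iff_ne_zero.mpr (Int.gcd_ne_zero_right (by
      exact_mod_cast hp.ne_zero)))
    refine Finset.card_le_one.mpr fun n hn n' hn' ↦ ?_
    simp only [Finset.mem_filter, Finset.mem_range] at hn hn'
    push_cast at hn hn'
    have hroot : (p : ℤ) ∣ f.eval (n : ℤ) := (dvd_pow_self _ two_ne_zero).trans hn.2.1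
    have hsub : (p : ℤ) ∣ (n' : ℤ) - n :=
      Nat.modEq_iff_dvd.mp (hn.2.2.trans hn'.2.2.symm)
    obtain ⟨c, hc⟩ := f.binomExpansion (n : ℤ) (n' - n)
    rw [add_sub_cancel] at hc
    have hmul : (p : ℤ) ^ 2 ∣ f.derivative.eval (n : ℤ) * (n' - n) := by
      have : f.derivative.eval (n : ℤ) * (n' - n) =
          f.eval (n' : ℤ) - f.eval (n : ℤ) - c * (n' - n) ^ 2 := by rw [hc]; ring
      rw [this]
      exact dvd_sub (dvd_sub hn'.2.1 hn.2.1) ((pow_dvd_pow_of_dvd hsub 2).mul_left c)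
    have hcop : IsCoprime ((p : ℤ) ^ 2) (f.derivative.eval (n : ℤ)) :=
      ((Nat.prime_iff_prime_int.mp hp).coprime_iff_not_dvd.mpr (hder _ hroot)).pow_left
    have hmod : n ≡ n' [MOD p ^ 2] :=
      Nat.modEq_iff_dvd.mpr (by push_cast; exact hcop.dvd_of_dvd_mul_left hmul)
    exact hmod.eq_of_lt_of_lt hn.1 hn'.1

theorem rho_sq_le {f : ℤ[X]} (hdeg : 1 ≤ f.natDegree) (hf : f.content = 1) {D : ℤ}
    (hD : (D : ℂ) = disc f) {q : ℕ} (hq : Squarefree q) :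
    rho f (q ^ 2) ≤ f.natDegree ^ q.primeFactors.card * Int.gcd D q := by
  induction q using induction_on_primes with
  | zero => exact absurd hq not_squarefree_zero
  | one =>
    refine (Finset.card_filter_le _ _).trans ?_
    simp
  | prime_mul p a hp ih =>
    have hcop : p.Coprime a := Nat.coprime_of_squarefree_mul hq
    have ha : Squarefree a := hq.of_mul_right
    have ha0 : 0 < a := Nat.pos_of_ne_zero ha.ne_zero
    have hgcd : Int.gcd D (p * a : ℕ) = Int.gcd D p * Int.gcd D a := by
      rw [Int.gcd, Int.natAbs_natCast, hcop.gcd_mul D.natAbs]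
      rfl
    rw [mul_pow, hcop.primeFactors_mul, Finset.card_union_of_disjoint hcop.disjoint_primeFactors,
      hp.primeFactors, Finset.card_singleton, pow_add, pow_one, hgcd]
    calc rho f (p ^ 2 * a ^ 2) ≤ rho f (p ^ 2) * rho f (a ^ 2) :=
          rho_mul_le f (pow_pos hp.pos 2) (pow_pos ha0 2) (hcop.pow 2 2)
      _ ≤ (f.natDegree * Int.gcd D p) * (f.natDegree ^ a.primeFactors.card * Int.gcd D a) :=
          Nat.mul_le_mul (rho_prime_sq_le hdeg hf hD hp) (ih ha)
      _ = _ := by ring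

theorem exists_pow_card_primeFactors_le (k : ℕ) (hk : 1 ≤ k) {ε : ℝ} (hε : 0 < ε) :
    ∃ C > 0, ∀ q : ℕ, q ≠ 0 → (k : ℝ) ^ q.primeFactors.card ≤ C * (q : ℝ) ^ ε := by
  have hk' : (1 : ℝ) ≤ k := by exact_mod_cast hk
  obtain ⟨T, hT⟩ : ∃ T : ℕ, ∀ n : ℕ, T ≤ n → (k : ℝ) ≤ (n : ℝ) ^ ε := by
    have := ((tendsto_rpow_atTop hε).comp tendsto_natCast_atTop_atTop).eventually_ge_atTop (k : ℝ)
    exact Filter.eventually_atTop.mp this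
  refine ⟨(k : ℝ) ^ T, by positivity, fun q hq ↦ ?_⟩
  calc (k : ℝ) ^ q.primeFactors.card = ∏ p ∈ q.primeFactors, (k : ℝ) := by simp
    _ ≤ ∏ p ∈ q.primeFactors, (if p < T then (k : ℝ) else 1) * (p : ℝ) ^ ε := by
        refine Finset.prod_le_prod (fun _ _ ↦ by positivity) fun p hp ↦ ?_
        have hp1 : (1 : ℝ) ≤ p := by exact_mod_cast (Nat.prime_of_mem_primeFactors hp).one_le
        split_ifs with h
        · exact le_mul_of_one_le_right (by positivity) (Real.one_le_rpow hp1 hε.le)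
        · simpa using hT p (not_lt.mp h)
    _ = (∏ p ∈ q.primeFactors with p < T, (k : ℝ)) * (∏ p ∈ q.primeFactors, (p : ℝ)) ^ ε := by
        rw [Finset.prod_mul_distrib, Finset.prod_filter,
          Real.finsetProd_rpow _ _ fun _ _ ↦ by positivity]
    _ ≤ (k : ℝ) ^ T * (q : ℝ) ^ ε := by
        have hcard : (q.primeFactors.filter (· < T)).card ≤ T := by
          refine (Finset.card_le_card fun p hp ↦ ?_).trans_eq (Finset.card_range T)
          exact Finset.mem_range.mpr (Finset.mem_filter.mp hp).2
        have hle : ∏ p ∈ q.primeFactors, (p : ℝ) ≤ q := by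
          rw [← Nat.cast_prod]
          exact_mod_cast Nat.le_of_dvd (Nat.pos_of_ne_zero hq) (Nat.prod_primeFactors_dvd q)
        rw [Finset.prod_const]
        gcongr

theorem squarefree_values_stmt2 (k : ℕ) (hk : 1 ≤ k) (ε : ℝ) (hε : 0 < ε) :
    ∃ C > 0, ∀ f : Polynomial ℤ, f.natDegree = k → f.content = 1 →
      ∀ D : ℤ, (D : ℂ) = disc f →
        ∀ q : ℕ, 0 < q → Squarefree q →
          (rho f (q ^ 2) : ℝ) ≤ C * (q : ℝ) ^ ε * (Int.gcd D (q : ℤ) : ℝ) := by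
  obtain ⟨C, hC, h⟩ := exists_pow_card_primeFactors_le k hk hε
  refine ⟨C, hC, fun f hfk hf D hD q hq hsq ↦ ?_⟩
  subst hfk
  calc (rho f (q ^ 2) : ℝ) ≤ (f.natDegree : ℝ) ^ q.primeFactors.card * Int.gcd D q := by
        exact_mod_cast rho_sq_le hk hf hD hsq
    _ ≤ _ := by
        gcongr
        exact h q hq.ne'
end

section
/- (Erdős–Turán inequality) Let (ξ_n) be a sequence in [0,1) and define the discrepancy Δ(N) = sup_{α ∈ [0,1)} | #{n ≤ N : ξ_n ≤ α} − αN |. Then for every integer L ≥ 1, Δ(N) ≪ N/L + ∑_{h=1}^{L} (1/h) |∑_{n=1}^{N} e(h ξ_n)|, with an absolute implied constant. -/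
open Finset

/-- The Fejér-type kernel `|∑ k < L, sin ((k + 1) θ) e(k t)|²`, expanded as a cosine polynomial. -/
noncomputable def sineKernel (L : ℕ) (θ t : ℝ) : ℝ :=
  ∑ k ∈ range L, ∑ l ∈ range L,
    Real.sin ((k + 1) * θ) * Real.sin ((l + 1) * θ) * Real.cos (2 * Real.pi * ((k - l : ℤ) : ℝ) * t)

/-- The squared `ℓ²` norm of the coefficients `sin ((k + 1) θ)`. -/
noncomputable def sineMass (L : ℕ) (θ : ℝ) : ℝ := ∑ k ∈ range L, Real.sin ((k + 1) * θ) ^ 2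

lemma sineKernel_nonneg (L : ℕ) (θ t : ℝ) : 0 ≤ sineKernel L θ t := by
  have h : sineKernel L θ t =
      (∑ k ∈ range L, Real.sin ((k + 1) * θ) * Real.cos (2 * Real.pi * k * t)) ^ 2 +
      (∑ k ∈ range L, Real.sin ((k + 1) * θ) * Real.sin (2 * Real.pi * k * t)) ^ 2 := by
    unfold sineKernel
    rw [sq, sq, sum_mul_sum, sum_mul_sum, ← sum_add_distrib]
    refine sum_congr rfl fun k _ => ?_
    rw [← sum_add_distrib]
    refine sum_congr rfl fun l _ => ?_
    have : 2 * Real.pi * ((k - l : ℤ) : ℝ) * t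
        = 2 * Real.pi * k * t - 2 * Real.pi * l * t := by push_cast; ring
    rw [this, Real.cos_sub]
    ring
  rw [h]
  positivity

lemma continuous_sineKernel (L : ℕ) (θ : ℝ) : Continuous (sineKernel L θ) := by
  unfold sineKernel
  fun_prop

lemma integral_cos_two_pi_int (h : ℤ) :
    ∫ t in (-(1 / 2) : ℝ)..(1 / 2), Real.cos (2 * Real.pi * (h : ℝ) * t) =
      if h = 0 then 1 else 0 := by
  split_ifs with h0
  · subst h0; norm_num
  · have hne : 2 * Real.pi * (h : ℝ) ≠ 0 := by
      have := Real.pi_ne_zero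
      have : (h : ℝ) ≠ 0 := by exact_mod_cast h0
      positivity
    rw [intervalIntegral.integral_comp_mul_left _ hne, integral_cos]
    have e1 : 2 * Real.pi * (h : ℝ) * (1 / 2) = h * Real.pi := by ring
    have e2 : 2 * Real.pi * (h : ℝ) * -(1 / 2) = -(h * Real.pi) := by ring
    rw [e1, e2, Real.sin_neg, Real.sin_int_mul_pi]
    simp

lemma integral_mul_sineKernel (L : ℕ) (θ : ℝ) (f : ℝ → ℝ)
    (hf : IntervalIntegrable f MeasureTheory.volume (-(1 / 2)) (1 / 2)) :
    ∫ t in (-(1 / 2) : ℝ)..(1 / 2), f t * sineKernel L θ t =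
      ∑ k ∈ range L, ∑ l ∈ range L, Real.sin ((k + 1) * θ) * Real.sin ((l + 1) * θ) *
        ∫ t in (-(1 / 2) : ℝ)..(1 / 2), f t * Real.cos (2 * Real.pi * ((k - l : ℤ) : ℝ) * t) := by
  have hi (c : ℝ) (h : ℤ) : IntervalIntegrable
      (fun t => c * (f t * Real.cos (2 * Real.pi * (h : ℝ) * t)))
      MeasureTheory.volume (-(1 / 2)) (1 / 2) :=
    (hf.mul_continuousOn (by fun_prop)).const_mul c
  have h1 : ∀ t, f t * sineKernel L θ t = ∑ k ∈ range L, ∑ l ∈ range L,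
      Real.sin ((k + 1) * θ) * Real.sin ((l + 1) * θ) *
        (f t * Real.cos (2 * Real.pi * ((k - l : ℤ) : ℝ) * t)) := by
    intro t
    unfold sineKernel
    rw [mul_sum]
    refine sum_congr rfl fun k _ => ?_
    rw [mul_sum]
    refine sum_congr rfl fun l _ => ?_
    ring
  simp_rw [h1]
  rw [intervalIntegral.integral_finsetSum]
  · refine sum_congr rfl fun k _ => ?_
    rw [intervalIntegral.integral_finsetSum]
    · refine sum_congr rfl fun l _ => ?_
      rw [intervalIntegral.integral_const_mul]
    · exact fun l _ => hi _ _
  · intro k _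
    have := IntervalIntegrable.sum (range L) (fun l (_ : l ∈ range L) =>
      hi (Real.sin ((k + 1) * θ) * Real.sin ((l + 1) * θ)) (k - l : ℤ))
    simpa [Finset.sum_fn] using this

lemma integral_sineKernel (L : ℕ) (θ : ℝ) :
    ∫ t in (-(1 / 2) : ℝ)..(1 / 2), sineKernel L θ t = sineMass L θ := by
  have := integral_mul_sineKernel L θ (fun _ => 1) (by simp)
  simp only [one_mul, integral_cos_two_pi_int] at this
  rw [this, sineMass]
  refine sum_congr rfl fun k hk => ?_
  rw [sum_eq_single k]
  · simp; ring
  · intro l _ hl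
    have : ((k : ℤ) - l) ≠ 0 := by omega
    simp [this]
  · intro h; exact absurd hk h

lemma integral_cos_mul_sineKernel (L : ℕ) (θ : ℝ) (hθ : Real.sin ((L + 1) * θ) = 0) :
    ∫ t in (-(1 / 2) : ℝ)..(1 / 2), Real.cos (2 * Real.pi * t) * sineKernel L θ t =
      Real.cos θ * sineMass L θ := by
  rw [integral_mul_sineKernel L θ _ (Continuous.intervalIntegrable (by fun_prop) _ _)]
  have key (h : ℤ) : ∫ t in (-(1 / 2) : ℝ)..(1 / 2),
      Real.cos (2 * Real.pi * t) * Real.cos (2 * Real.pi * (h : ℝ) * t) =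
        (1 / 2) * (if h = 1 then 1 else 0) + (1 / 2) * (if h = -1 then 1 else 0) := by
    have e : ∀ t : ℝ, Real.cos (2 * Real.pi * t) * Real.cos (2 * Real.pi * (h : ℝ) * t) =
        (1 / 2) * Real.cos (2 * Real.pi * ((h - 1 : ℤ) : ℝ) * t) +
        (1 / 2) * Real.cos (2 * Real.pi * ((h + 1 : ℤ) : ℝ) * t) := by
      intro t
      have e1 : 2 * Real.pi * ((h - 1 : ℤ) : ℝ) * t
        = 2 * Real.pi * (h : ℝ) * t - 2 * Real.pi * t := by push_cast; ring
      have e2 : 2 * Real.pi * ((h + 1 : ℤ) : ℝ) * t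
        = 2 * Real.pi * (h : ℝ) * t + 2 * Real.pi * t := by push_cast; ring
      rw [e1, e2, Real.cos_sub, Real.cos_add]
      ring
    simp_rw [e]
    rw [intervalIntegral.integral_add (Continuous.intervalIntegrable (by fun_prop) _ _)
      (Continuous.intervalIntegrable (by fun_prop) _ _), intervalIntegral.integral_const_mul,
      intervalIntegral.integral_const_mul, integral_cos_two_pi_int, integral_cos_two_pi_int]
    simp only [sub_eq_zero, add_eq_zero_iff_eq_neg]
  simp_rw [key]
  rw [sineMass, mul_sum]
  refine sum_congr rfl fun k hk => ?_
  have hk' := mem_range.1 hk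
  have s1 : ∑ l ∈ range L, Real.sin ((l + 1) * θ) * (if (k - l : ℤ) = 1 then 1 else 0)
      = Real.sin (k * θ) := by
    rcases k with _ | j
    · simp only [Nat.cast_zero, zero_mul, Real.sin_zero]
      refine sum_eq_zero fun l _ => ?_
      rw [if_neg (by omega), mul_zero]
    · rw [sum_eq_single j]
      · simp
      · intro l _ hl
        rw [if_neg (by push_cast; omega), mul_zero]
      · intro h
        exact absurd (mem_range.2 (by omega)) h
  have s2 : ∑ l ∈ range L, Real.sin ((l + 1) * θ) * (if (k - l : ℤ) = -1 then 1 else 0)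
      = Real.sin ((k + 2) * θ) := by
    by_cases h : k + 1 < L
    · rw [sum_eq_single (k + 1)]
      · simp; ring_nf
      · intro l _ hl
        rw [if_neg (by omega), mul_zero]
      · intro h'
        exact absurd (mem_range.2 h) h'
    · have : (k : ℝ) + 2 = L + 1 := by
        have : k + 1 = L := by omega
        rw [← this]; push_cast; ring
      rw [this, hθ]
      refine sum_eq_zero fun l hl => ?_
      have := mem_range.1 hl
      rw [if_neg (by omega), mul_zero]
  have s3 : Real.sin (k * θ) + Real.sin ((k + 2) * θ) =
      2 * Real.cos θ * Real.sin ((k + 1) * θ) := by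
    have e1 : (k : ℝ) * θ = (k + 1) * θ - θ := by ring
    have e2 : ((k : ℝ) + 2) * θ = (k + 1) * θ + θ := by ring
    rw [e1, e2, Real.sin_sub, Real.sin_add]
    ring
  calc _ = (1 / 2) * Real.sin ((k + 1) * θ) *
        (∑ l ∈ range L, Real.sin ((l + 1) * θ) * (if (k - l : ℤ) = 1 then 1 else 0) +
        ∑ l ∈ range L, Real.sin ((l + 1) * θ) * (if (k - l : ℤ) = -1 then 1 else 0)) := by
        rw [← sum_add_distrib, mul_sum]
        refine sum_congr rfl fun l _ => ?_
        ring
    _ = _ := by rw [s1, s2, s3]; ring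

lemma integral_sin_sq_mul_sineKernel (L : ℕ) (θ : ℝ) (hθ : Real.sin ((L + 1) * θ) = 0) :
    ∫ t in (-(1 / 2) : ℝ)..(1 / 2), Real.sin (Real.pi * t) ^ 2 * sineKernel L θ t =
      (1 - Real.cos θ) / 2 * sineMass L θ := by
  have e : ∀ t : ℝ, Real.sin (Real.pi * t) ^ 2 * sineKernel L θ t =
      (1 / 2) * sineKernel L θ t -
        (1 / 2) * (Real.cos (2 * Real.pi * t) * sineKernel L θ t) := by
    intro t
    have : 2 * Real.pi * t = 2 * (Real.pi * t) := by ring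
    rw [Real.sin_sq_eq_half_sub, this]
    ring
  have hc := continuous_sineKernel L θ
  simp_rw [e]
  rw [intervalIntegral.integral_sub (Continuous.intervalIntegrable (by fun_prop) _ _)
      (Continuous.intervalIntegrable (by fun_prop) _ _), intervalIntegral.integral_const_mul,
      intervalIntegral.integral_const_mul, integral_cos_mul_sineKernel L θ hθ,
      integral_sineKernel]
  ring

lemma sineMass_pos {L : ℕ} (hL : 1 ≤ L) : 0 < sineMass L (Real.pi / (L + 1)) := by
  have hp := Real.pi_pos
  refine sum_pos (fun k hk => ?_) ⟨0, mem_range.2 hL⟩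
  have hk' : (k : ℝ) + 1 < L + 1 := by exact_mod_cast Nat.succ_lt_succ (mem_range.1 hk)
  refine pow_pos (Real.sin_pos_of_pos_of_lt_pi (by positivity) ?_) 2
  rw [mul_div_assoc', div_lt_iff₀ (by positivity)]
  nlinarith

lemma sq_le_sin_pi_mul_sq {t : ℝ} (ht : |t| ≤ 1 / 2) : 4 * t ^ 2 ≤ Real.sin (Real.pi * t) ^ 2 := by
  have hp := Real.pi_pos
  have h := Real.mul_le_sin (x := Real.pi * |t|) (by positivity) (by nlinarith)
  have e : 2 / Real.pi * (Real.pi * |t|) = 2 * |t| := by field_simp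
  rw [e] at h
  have h2 : Real.sin (Real.pi * |t|) ^ 2 = Real.sin (Real.pi * t) ^ 2 := by
    rcases abs_cases t with ⟨h, _⟩ | ⟨h, _⟩ <;> rw [h]
    rw [mul_neg, Real.sin_neg, neg_sq]
  rw [← h2, ← sq_abs t]
  nlinarith [abs_nonneg t]

/-- A bounded function that decreases with slope at most `a` and whose cosine coefficients are
bounded by `w` is bounded above by an average of `w`, up to half its sup norm. -/
lemma le_half_add_of_cos_coeff_le {G : ℝ → ℝ} {w : ℤ → ℝ} {a M W : ℝ} {L : ℕ} (hL : 1 ≤ L)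
    (ha : 0 ≤ a) (hG : Measurable G) (hM : ∀ x, |G x| ≤ M)
    (hslope : ∀ x s, 0 ≤ s → G x - a * s ≤ G (x + s))
    (hw : ∀ x (h : ℤ), |∫ t in (-(1 / 2) : ℝ)..(1 / 2),
      G (x + t) * Real.cos (2 * Real.pi * (h : ℝ) * t)| ≤ w h)
    (hweven : ∀ h, w (-h) = w h)
    (hW : ∀ k < L, ∑ l ∈ range L, w (k - l) ≤ W) (x : ℝ) :
    G x ≤ M / 2 + (a * Real.pi / (L + 1) + W) := by
  have hp := Real.pi_pos
  set θ : ℝ := Real.pi / (L + 1) with hθ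
  have hθ0 : 0 < θ := by positivity
  have hM0 : 0 ≤ M := (abs_nonneg _).trans (hM 0)
  have hsin : Real.sin ((L + 1) * θ) = 0 := by
    rw [hθ, mul_div_cancel₀ _ (by positivity), Real.sin_pi]
  have hA : 0 < sineMass L θ := sineMass_pos hL
  have hGi (y : ℝ) : IntervalIntegrable (fun t => G (y + t)) MeasureTheory.volume
      (-(1 / 2)) (1 / 2) := by
    rw [intervalIntegrable_iff]
    refine MeasureTheory.Measure.integrableOn_of_bounded (M := M) (by simp)
      (hG.comp (measurable_const_add y)).aestronglyMeasurable (Filter.Eventually.of_forall fun t => ?_)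
    exact hM _
  have hK := continuous_sineKernel L θ
  have upper : ∫ t in (-(1 / 2) : ℝ)..(1 / 2), G (x + θ / 2 + t) * sineKernel L θ t ≤
      sineMass L θ * W := by
    rw [integral_mul_sineKernel L θ _ (hGi _)]
    have hw0 (h : ℤ) : 0 ≤ w h := (abs_nonneg _).trans (hw 0 h)
    set p : ℕ → ℝ := fun k => Real.sin ((k + 1) * θ) with hpdef
    calc _ ≤ ∑ k ∈ range L, ∑ l ∈ range L,
          (p k ^ 2 / 2 * w (k - l) + p l ^ 2 / 2 * w (k - l)) := by
          refine sum_le_sum fun k _ => sum_le_sum fun l _ => ?_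
          refine (le_abs_self _).trans ?_
          rw [abs_mul]
          refine (mul_le_mul_of_nonneg_left (hw _ _) (abs_nonneg _)).trans ?_
          rw [← add_mul]
          refine mul_le_mul_of_nonneg_right ?_ (hw0 _)
          rw [abs_le]
          constructor <;> nlinarith [sq_nonneg (p k + p l), sq_nonneg (p k - p l)]
      _ = ∑ k ∈ range L, ∑ l ∈ range L, p k ^ 2 * w (k - l) := by
          simp_rw [sum_add_distrib]
          nth_rewrite 2 [sum_comm]
          rw [← sum_add_distrib]
          refine sum_congr rfl fun k _ => ?_
          rw [← sum_add_distrib]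
          refine sum_congr rfl fun l _ => ?_
          rw [← hweven (l - k : ℤ), neg_sub]
          ring
      _ ≤ ∑ k ∈ range L, p k ^ 2 * W := by
          refine sum_le_sum fun k hk => ?_
          rw [← mul_sum]
          exact mul_le_mul_of_nonneg_left (hW k (mem_range.1 hk)) (sq_nonneg _)
      _ = _ := by rw [← sum_mul, sineMass]
  have lower : (G x - a * θ) * sineMass L θ - 2 * M / θ ^ 2 *
      ((1 - Real.cos θ) / 2 * sineMass L θ) ≤
      ∫ t in (-(1 / 2) : ℝ)..(1 / 2), G (x + θ / 2 + t) * sineKernel L θ t := by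
    rw [← integral_sin_sq_mul_sineKernel L θ hsin]
    nth_rewrite 1 [← integral_sineKernel]
    rw [← intervalIntegral.integral_const_mul, ← intervalIntegral.integral_const_mul,
      ← intervalIntegral.integral_sub (Continuous.intervalIntegrable (by fun_prop) _ _)
      (Continuous.intervalIntegrable (by fun_prop) _ _)]
    refine intervalIntegral.integral_mono_on (by norm_num)
      (Continuous.intervalIntegrable (by fun_prop) _ _)
      ((hGi _).mul_continuousOn hK.continuousOn) fun t ht => ?_
    rw [← mul_assoc, ← sub_mul]
    refine mul_le_mul_of_nonneg_right ?_ (sineKernel_nonneg L θ t)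
    have hs0 : 0 ≤ 2 * M / θ ^ 2 * Real.sin (Real.pi * t) ^ 2 := by positivity
    by_cases htθ : |t| ≤ θ / 2
    · have h1 := abs_le.1 htθ
      have h2 := hslope x (θ / 2 + t) (by linarith)
      rw [← add_assoc] at h2
      nlinarith
    · push Not at htθ
      have h1 := sq_le_sin_pi_mul_sq (abs_le.2 ⟨ht.1, ht.2⟩)
      have h2 : (θ / 2) ^ 2 ≤ t ^ 2 := by
        rw [← sq_abs t]; exact pow_le_pow_left₀ (by positivity) htθ.le 2
      have h3 : 2 * M ≤ 2 * M / θ ^ 2 * Real.sin (Real.pi * t) ^ 2 := by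
        rw [div_mul_eq_mul_div, le_div_iff₀ (by positivity)]
        exact mul_le_mul_of_nonneg_left (by linarith) (by positivity)
      have h4 := (abs_le.1 (hM x)).2
      have h5 := (abs_le.1 (hM (x + θ / 2 + t))).1
      nlinarith
  have hcos : 2 * M / θ ^ 2 * ((1 - Real.cos θ) / 2 * sineMass L θ) ≤ M / 2 * sineMass L θ := by
    rw [← mul_assoc]
    refine mul_le_mul_of_nonneg_right ?_ hA.le
    have := Real.one_sub_sq_div_two_le_cos (x := θ)
    rw [div_mul_eq_mul_div, div_le_iff₀ (by positivity)]
    nlinarith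
  have : (G x - a * θ - M / 2) * sineMass L θ ≤ W * sineMass L θ := by linarith
  have := le_of_mul_le_mul_right this hA
  have e : a * Real.pi / (L + 1) = a * θ := by rw [hθ]; ring
  linarith

/-- The sawtooth function `1/2 - {x}`. -/
noncomputable def sawtooth (x : ℝ) : ℝ := 1 / 2 - Int.fract x

lemma measurable_sawtooth : Measurable sawtooth := measurable_const.sub measurable_fract

lemma abs_sawtooth_le (x : ℝ) : |sawtooth x| ≤ 1 / 2 := by
  have h0 := Int.fract_nonneg x
  have h1 := Int.fract_lt_one x
  rw [sawtooth, abs_le]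
  constructor <;> linarith

lemma sawtooth_sub_le (x : ℝ) {s : ℝ} (hs : 0 ≤ s) : sawtooth x - s ≤ sawtooth (x + s) := by
  have h1 := Int.fract_add_le x s
  have h2 : Int.fract s ≤ s := by
    have : (0 : ℝ) ≤ ⌊s⌋ := by exact_mod_cast Int.floor_nonneg.2 hs
    rw [Int.fract]; linarith
  unfold sawtooth
  linarith

lemma integral_sawtooth_mul_cos (y : ℝ) (h : ℤ) :
    ∫ t in (-(1 / 2) : ℝ)..(1 / 2), sawtooth (y + t) * Real.cos (2 * Real.pi * (h : ℝ) * t) =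
      Real.sin (2 * Real.pi * h * y) / (2 * Real.pi * h) := by
  have hper : Function.Periodic
      (fun t => sawtooth (y + t) * Real.cos (2 * Real.pi * (h : ℝ) * t)) 1 := by
    intro t
    have e : 2 * Real.pi * (h : ℝ) * (t + 1) = 2 * Real.pi * h * t + h * (2 * Real.pi) := by ring
    simp only [sawtooth]
    rw [e, Real.cos_add_int_mul_two_pi, ← add_assoc, Int.fract_add_one]
  have h1 := hper.intervalIntegral_add_eq (-(1 / 2)) (-y)
  rw [show (-(1 / 2) : ℝ) + 1 = 1 / 2 by norm_num] at h1
  rw [h1]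
  have h2 : ∫ t in (-y)..(-y + 1), sawtooth (y + t) * Real.cos (2 * Real.pi * (h : ℝ) * t) =
      ∫ t in (-y)..(-y + 1), (1 / 2 - y - t) * Real.cos (2 * Real.pi * (h : ℝ) * t) := by
    refine intervalIntegral.integral_congr_Ioo_of_le (by linarith) fun t ht => ?_
    have : Int.fract (y + t) = y + t :=
      Int.fract_eq_self.2 ⟨by linarith [ht.1], by linarith [ht.2]⟩
    simp only [sawtooth, this]
    ring
  rw [h2]
  by_cases h0 : h = 0
  · subst h0
    simp only [Int.cast_zero, mul_zero, zero_mul, Real.cos_zero, mul_one, div_zero]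
    rw [intervalIntegral.integral_sub (by simp) (by simp)]
    simp
    ring
  · have hc : 2 * Real.pi * (h : ℝ) ≠ 0 := by
      have : (h : ℝ) ≠ 0 := by exact_mod_cast h0
      have := Real.pi_ne_zero
      positivity
    set c := 2 * Real.pi * (h : ℝ) with hcdef
    have hd : ∀ t ∈ Set.uIcc (-y) (-y + 1), HasDerivAt
        (fun t => (1 / 2 - y - t) * (Real.sin (c * t) / c) - Real.cos (c * t) / c ^ 2)
        ((1 / 2 - y - t) * Real.cos (c * t)) t := by
      intro t _
      have hl : HasDerivAt (fun t : ℝ => c * t) c t := by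
        simpa using (hasDerivAt_id t).const_mul c
      have hs := hl.sin.div_const c
      have hk := hl.cos.div_const (c ^ 2)
      have hm : HasDerivAt (fun t : ℝ => 1 / 2 - y - t) (-1) t := by
        simpa using (hasDerivAt_id t).const_sub (1 / 2 - y)
      refine ((hm.mul hs).sub hk).congr_deriv ?_
      field_simp
      ring
    rw [intervalIntegral.integral_eq_sub_of_hasDerivAt hd
      (Continuous.intervalIntegrable (by fun_prop) _ _)]
    have e1 : c * (-y + 1) = -(c * y) + h * (2 * Real.pi) := by rw [hcdef]; ring
    have e2 : c * -y = -(c * y) := by ring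
    rw [e1, e2, Real.sin_add_int_mul_two_pi, Real.cos_add_int_mul_two_pi, Real.sin_neg]
    ring

/-- The exponential sum `∑ n ≤ N, e(h ξ n)`. -/
noncomputable def expSum (ξ : ℕ → ℝ) (N h : ℕ) : ℂ :=
  ∑ n ∈ Icc 1 N, Complex.exp (2 * Real.pi * Complex.I * (h * ξ n))

lemma abs_sum_sin_le_norm_expSum (ξ : ℕ → ℝ) (N : ℕ) (h : ℤ) (x : ℝ) :
    |∑ n ∈ Icc 1 N, Real.sin (2 * Real.pi * h * (x - ξ n))| ≤ ‖expSum ξ N h.natAbs‖ := by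
  have hnat (m : ℕ) : |∑ n ∈ Icc 1 N, Real.sin (2 * Real.pi * m * (x - ξ n))| ≤
      ‖expSum ξ N m‖ := by
    have e : ∑ n ∈ Icc 1 N, Real.sin (2 * Real.pi * m * (x - ξ n)) =
        -(Complex.exp ((-(2 * Real.pi * m * x) : ℝ) * Complex.I) * expSum ξ N m).im := by
      rw [expSum, mul_sum, Complex.im_sum, ← sum_neg_distrib]
      refine sum_congr rfl fun n _ => ?_
      rw [← Complex.exp_add]
      have : ((-(2 * Real.pi * m * x) : ℝ) : ℂ) * Complex.I +
          2 * Real.pi * Complex.I * (m * ξ n) =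
          ((-(2 * Real.pi * m * (x - ξ n)) : ℝ) : ℂ) * Complex.I := by
        push_cast; ring
      rw [this, Complex.exp_ofReal_mul_I_im, Real.sin_neg, neg_neg]
    rw [e, abs_neg]
    refine (Complex.abs_im_le_norm _).trans ?_
    rw [norm_mul, Complex.norm_exp_ofReal_mul_I, one_mul]
  rcases Int.natAbs_eq h with hh | hh
  · have := hnat h.natAbs
    rw [← Int.cast_natCast (R := ℝ), ← hh] at this
    exact this
  · have := hnat h.natAbs
    have e : (h.natAbs : ℝ) = -(h : ℝ) := by
      rw [← Int.cast_natCast (R := ℝ)]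
      have : ((h.natAbs : ℤ)) = -h := by omega
      rw [this]; push_cast; ring
    rw [e] at this
    simpa only [mul_neg, neg_mul, Real.sin_neg, sum_neg_distrib, abs_neg] using this

lemma sum_range_natAbs_sub_le {g : ℕ → ℝ} (hg : ∀ h, 0 ≤ g h) (hg0 : g 0 = 0) {L k : ℕ}
    (hk : k < L) :
    ∑ l ∈ range L, g ((k - l : ℤ).natAbs) ≤ 2 * ∑ h ∈ Icc 1 L, g h := by
  obtain ⟨m, rfl⟩ : ∃ m, L = k + 1 + m := ⟨L - (k + 1), by omega⟩
  rw [sum_range_add, two_mul]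
  refine add_le_add ?_ ?_
  · have e : ∑ l ∈ range (k + 1), g ((k - l : ℤ).natAbs) = ∑ h ∈ range (k + 1), g h := by
      rw [← sum_range_reflect]
      refine sum_congr rfl fun l hl => ?_
      have := mem_range.1 hl
      congr 1
      omega
    rw [e, sum_range_succ', hg0, add_zero, range_eq_Ico, sum_Ico_add' g 0 k 1]
    refine sum_le_sum_of_subset_of_nonneg (fun i hi => ?_) fun i _ _ => hg i
    simp only [mem_Ico, mem_Icc] at *
    omega
  · have e : ∑ l ∈ range m, g ((k - (k + 1 + l : ℕ) : ℤ).natAbs) = ∑ l ∈ range m, g (l + 1) := by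
      refine sum_congr rfl fun l _ => ?_
      congr 1
      omega
    rw [e, range_eq_Ico, sum_Ico_add' g 0 m 1]
    refine sum_le_sum_of_subset_of_nonneg (fun i hi => ?_) fun i _ _ => hg i
    simp only [mem_Ico, mem_Icc] at *
    omega

/-- The discrepancy function normalised to have mean zero. -/
noncomputable def sawtoothSum (ξ : ℕ → ℝ) (N : ℕ) (x : ℝ) : ℝ := ∑ n ∈ Icc 1 N, sawtooth (x - ξ n)

lemma measurable_sawtoothSum (ξ : ℕ → ℝ) (N : ℕ) : Measurable (sawtoothSum ξ N) :=
  Finset.measurable_fun_sum _ fun n _ => measurable_sawtooth.comp (measurable_id.sub_const (ξ n))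

lemma abs_sawtoothSum_le (ξ : ℕ → ℝ) (N : ℕ) (x : ℝ) : |sawtoothSum ξ N x| ≤ N := by
  refine (abs_sum_le_sum_abs _ _).trans ?_
  refine (sum_le_card_nsmul _ _ 1 fun n _ => (abs_sawtooth_le _).trans (by norm_num)).trans ?_
  simp

lemma sawtoothSum_sub_le (ξ : ℕ → ℝ) (N : ℕ) (x : ℝ) {s : ℝ} (hs : 0 ≤ s) :
    sawtoothSum ξ N x - N * s ≤ sawtoothSum ξ N (x + s) := by
  have e : (N : ℝ) * s = ∑ n ∈ Icc 1 N, s := by simp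
  rw [e, sawtoothSum, sawtoothSum, ← sum_sub_distrib]
  refine sum_le_sum fun n _ => ?_
  rw [add_sub_right_comm]
  exact sawtooth_sub_le _ hs

lemma abs_integral_sawtoothSum_mul_cos_le (ξ : ℕ → ℝ) (N : ℕ) (x : ℝ) (h : ℤ) :
    |∫ t in (-(1 / 2) : ℝ)..(1 / 2),
      sawtoothSum ξ N (x + t) * Real.cos (2 * Real.pi * (h : ℝ) * t)| ≤
      1 / (h.natAbs : ℝ) * ‖expSum ξ N h.natAbs‖ := by
  have hp := Real.pi_gt_three
  have e : ∫ t in (-(1 / 2) : ℝ)..(1 / 2),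
      sawtoothSum ξ N (x + t) * Real.cos (2 * Real.pi * (h : ℝ) * t) =
      (∑ n ∈ Icc 1 N, Real.sin (2 * Real.pi * h * (x - ξ n))) / (2 * Real.pi * h) := by
    simp_rw [sawtoothSum, sum_mul]
    rw [intervalIntegral.integral_finsetSum, sum_div]
    · refine sum_congr rfl fun n _ => ?_
      rw [← integral_sawtooth_mul_cos]
      simp_rw [add_sub_right_comm]
    · intro n _
      refine IntervalIntegrable.mul_continuousOn ?_ (by fun_prop)
      rw [intervalIntegrable_iff]
      refine MeasureTheory.Measure.integrableOn_of_bounded (M := 1 / 2) (by simp)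
        (measurable_sawtooth.comp
          ((measurable_const_add x).sub_const (ξ n))).aestronglyMeasurable
        (Filter.Eventually.of_forall fun t => abs_sawtooth_le _)
  rw [e, abs_div, div_eq_mul_one_div, mul_comm]
  refine mul_le_mul ?_ (abs_sum_sin_le_norm_expSum ξ N h x) (abs_nonneg _) (by positivity)
  rw [abs_mul, Nat.cast_natAbs, Int.cast_abs]
  by_cases h0 : h = 0
  · simp [h0]
  · have : 0 < |(h : ℝ)| := abs_pos.2 (by exact_mod_cast h0)
    refine one_div_le_one_div_of_le this (le_mul_of_one_le_left this.le ?_)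
    rw [abs_of_pos (by positivity)]
    linarith

lemma abs_sawtoothSum_le_expSum (ξ : ℕ → ℝ) (N : ℕ) {L : ℕ} (hL : 1 ≤ L) (x : ℝ) :
    |sawtoothSum ξ N x| ≤ 2 * (N * Real.pi / (L + 1) +
      2 * ∑ h ∈ Icc 1 L, 1 / (h : ℝ) * ‖expSum ξ N h‖) := by
  set R := N * Real.pi / (L + 1) + 2 * ∑ h ∈ Icc 1 L, 1 / (h : ℝ) * ‖expSum ξ N h‖ with hR
  let w : ℤ → ℝ := fun h => 1 / (h.natAbs : ℝ) * ‖expSum ξ N h.natAbs‖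
  have hweven (h : ℤ) : w (-h) = w h := by simp only [w, Int.natAbs_neg]
  have hW : ∀ k < L, ∑ l ∈ range L, w (k - l) ≤
      2 * ∑ h ∈ Icc 1 L, 1 / (h : ℝ) * ‖expSum ξ N h‖ := fun k hk =>
    sum_range_natAbs_sub_le (g := fun h => 1 / (h : ℝ) * ‖expSum ξ N h‖)
      (fun h => by positivity) (by simp) hk
  have hbdd : BddAbove (Set.range fun y => |sawtoothSum ξ N y|) :=
    ⟨N, by rintro _ ⟨y, rfl⟩; exact abs_sawtoothSum_le ξ N y⟩
  have half (y : ℝ) : |sawtoothSum ξ N y| ≤ (⨆ z, |sawtoothSum ξ N z|) / 2 + R := by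
    have hM (z : ℝ) := le_ciSup hbdd z
    refine abs_le'.2 ⟨?_, ?_⟩
    · exact le_half_add_of_cos_coeff_le hL N.cast_nonneg (measurable_sawtoothSum ξ N) hM
        (fun z s hs => sawtoothSum_sub_le ξ N z hs)
        (abs_integral_sawtoothSum_mul_cos_le ξ N) hweven hW y
    · have := le_half_add_of_cos_coeff_le (G := fun z => -sawtoothSum ξ N (-z)) hL
        N.cast_nonneg ((measurable_sawtoothSum ξ N).comp measurable_neg).neg
        (M := ⨆ z, |sawtoothSum ξ N z|) (fun z => by rw [abs_neg]; exact hM (-z))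
        (fun z s hs => by
          have := sawtoothSum_sub_le ξ N (-(z + s)) hs
          rw [show -(z + s) + s = -z by ring] at this
          linarith)
        (fun z h => by
          have h1 := abs_integral_sawtoothSum_mul_cos_le ξ N (-z) h
          have h2 := intervalIntegral.integral_comp_neg (a := -(1 / 2)) (b := 1 / 2)
            (fun t => sawtoothSum ξ N (-z + t) * Real.cos (2 * Real.pi * (h : ℝ) * t))
          rw [neg_neg] at h2
          rw [← h2, ← abs_neg, ← intervalIntegral.integral_neg] at h1
          convert h1 using 5 with t
          rw [mul_neg, Real.cos_neg, neg_add, neg_mul])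
        hweven hW (-y)
      simpa only [neg_neg] using this
  have hsup : (⨆ z, |sawtoothSum ξ N z|) ≤ (⨆ z, |sawtoothSum ξ N z|) / 2 + R := ciSup_le half
  have := half x
  linarith

lemma card_filter_sub_eq_sawtoothSum_add {ξ : ℕ → ℝ} (hξ : ∀ n, ξ n ∈ Set.Ico (0 : ℝ) 1) (N : ℕ)
    {α : ℝ} (hα : α ∈ Set.Ico (0 : ℝ) 1) :
    (((Icc 1 N).filter (fun n => ξ n ≤ α)).card : ℝ) - α * N =
      sawtoothSum ξ N α + ∑ n ∈ Icc 1 N, (1 / 2 - ξ n) := by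
  have e : α * (N : ℝ) = ∑ n ∈ Icc 1 N, α := by simp [mul_comm]
  rw [e, card_filter, Nat.cast_sum, ← sum_sub_distrib, sawtoothSum, ← sum_add_distrib]
  refine sum_congr rfl fun n _ => ?_
  obtain ⟨h0, h1⟩ := hξ n
  obtain ⟨a0, a1⟩ := hα
  unfold sawtooth
  split_ifs with h
  · rw [Int.fract_eq_self.2 ⟨by linarith, by linarith⟩]
    push_cast
    ring
  · rw [← Int.fract_add_one, Int.fract_eq_self.2 ⟨by linarith, by linarith⟩]
    push_cast
    ring

lemma abs_sum_half_sub_le {ξ : ℕ → ℝ} (hξ : ∀ n, ξ n ∈ Set.Ico (0 : ℝ) 1) (N : ℕ) {B ε : ℝ}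
    (hε : 0 < ε) (hB : ∀ x, |sawtoothSum ξ N x| ≤ B) :
    |∑ n ∈ Icc 1 N, (1 / 2 - ξ n)| ≤ B + N * ε := by
  have hev : ∀ᶠ x in nhdsWithin (1 : ℝ) (Set.Iio 1),
      (∀ n ∈ Icc 1 N, ξ n < x) ∧ 0 < x ∧ 1 - ε < x ∧ x < 1 := by
    refine Filter.Eventually.and ((Filter.eventually_all_finset _).2 fun n _ => ?_) ?_
    · exact nhdsWithin_le_nhds (lt_mem_nhds (hξ n).2)
    · have h0 : ∀ᶠ x in nhdsWithin (1 : ℝ) (Set.Iio 1), 0 < x :=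
        nhdsWithin_le_nhds (lt_mem_nhds one_pos)
      have h1 : ∀ᶠ x in nhdsWithin (1 : ℝ) (Set.Iio 1), 1 - ε < x :=
        nhdsWithin_le_nhds (lt_mem_nhds (by linarith))
      exact h0.and (h1.and self_mem_nhdsWithin)
  obtain ⟨x, hx, x0, hxε, x1⟩ := hev.exists
  have h := card_filter_sub_eq_sawtoothSum_add hξ N (α := x) ⟨x0.le, x1⟩
  rw [filter_true_of_mem fun n hn => (hx n hn).le, Nat.card_Icc, Nat.add_sub_cancel] at h
  have hN : (0 : ℝ) ≤ N := N.cast_nonneg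
  have hb := abs_le.1 (hB x)
  rw [abs_le]
  constructor <;> nlinarith

/-- The Erdős–Turán inequality: the discrepancy of a sequence `ξ_n ∈ [0,1)` is bounded,
for every `L ≥ 1`, by `N/L` plus a weighted sum of exponential sums. -/
theorem squarefree_values_stmt12 :
    ∃ C > 0, ∀ ξ : ℕ → ℝ, (∀ n, ξ n ∈ Set.Ico (0 : ℝ) 1) →
      ∀ N L : ℕ, 1 ≤ L → ∀ α ∈ Set.Ico (0 : ℝ) 1,
        |(((Finset.Icc 1 N).filter (fun n => ξ n ≤ α)).card : ℝ) - α * N| ≤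
          C * ((N : ℝ) / L + ∑ h ∈ Finset.Icc 1 L, (1 / (h : ℝ)) *
            ‖∑ n ∈ Finset.Icc 1 N, Complex.exp (2 * Real.pi * Complex.I * (h * ξ n))‖) := by
  refine ⟨17, by norm_num, fun ξ hξ N L hL α hα => ?_⟩
  have hL0 : (0 : ℝ) < L := by exact_mod_cast hL
  have hN : (0 : ℝ) ≤ N := N.cast_nonneg
  have hB := abs_sawtoothSum_le_expSum ξ N hL
  have hc := abs_sum_half_sub_le hξ N (one_div_pos.2 hL0) hB
  rw [card_filter_sub_eq_sawtoothSum_add hξ N hα]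
  refine (abs_add_le _ _).trans ((add_le_add (hB α) hc).trans ?_)
  have hS : 0 ≤ ∑ h ∈ Icc 1 L, 1 / (h : ℝ) * ‖expSum ξ N h‖ :=
    sum_nonneg fun h _ => by positivity
  have hπ : N * Real.pi / (L + 1) ≤ 4 * (N / L : ℝ) := by
    rw [← mul_div_assoc, mul_comm 4 (N : ℝ)]
    gcongr
    · exact Real.pi_le_four
    · linarith
  rw [mul_one_div]
  change _ ≤ 17 * ((N : ℝ) / L + ∑ h ∈ Icc 1 L, 1 / (h : ℝ) * ‖expSum ξ N h‖)
  linarith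
end

section
/- Let f ∈ ℤ[X] be an irreducible polynomial of degree k ≥ 2 with coefficients bounded in absolute value by H and content 1. For S, N ≥ 1 let Q_f(S,N) be the number of triples (n,r,s) ∈ ℤ³ with 1 ≤ n ≤ N, 1 ≤ s ≤ S and f(n) = s r². Then Q_f(S,N) ≤ (N^{1/2} S^{1/2} + S) (HN)^{o(1)}. -/
open Polynomial

theorem exists_forall_prime_not_dvd (δ : ℝ) (hδ : 0 < δ) :
    ∃ C : ℝ, 1 ≤ C ∧ ∀ m : ℕ, m ≠ 0 → ∃ p : ℕ, p.Prime ∧ ¬ p ∣ m ∧ (p : ℝ) ≤ C * (m : ℝ) ^ δ := by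
  have key : ∀ᶠ n : ℕ in Filter.atTop, Real.log n ≤ δ * Chebyshev.theta n := by
    have h1 : (fun x : ℝ => Real.log x) =o[Filter.atTop] (fun x : ℝ => x ^ (1 / 4 : ℝ)) :=
      isLittleO_log_rpow_atTop (by norm_num)
    have h2 := (h1.bound (show (0 : ℝ) < 1 / 16 by norm_num)).and
      ((h1.bound (show (0 : ℝ) < δ / 16 by positivity)).and (Filter.eventually_ge_atTop 16))
    filter_upwards [tendsto_natCast_atTop_atTop.eventually h2] with n hn
    obtain ⟨ha, hb, hc⟩ := hn
    have hn0 : (0 : ℝ) < n := by linarith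
    have hlog : 0 ≤ Real.log n := Real.log_nonneg (by linarith)
    rw [Real.norm_of_nonneg hlog, Real.norm_of_nonneg (by positivity)] at ha hb
    set t : ℝ := (n : ℝ) ^ (1 / 4 : ℝ) with ht
    have ht4 : t ^ 4 = n := by
      rw [ht, ← Real.rpow_natCast, ← Real.rpow_mul hn0.le]; norm_num
    have ht0 : 0 < t := by positivity
    have hs : √(n : ℝ) = t ^ 2 := by
      rw [← ht4, show t ^ 4 = (t ^ 2) ^ 2 by ring, Real.sqrt_sq (by positivity)]
    have ht2 : 2 ≤ t := by
      by_contra! h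
      have : t ^ 4 < 2 ^ 4 := by gcongr
      linarith
    have h3 := Chebyshev.theta_ge n
    have h4 : Real.log (n + 1) ≤ Real.log 2 + Real.log n := by
      rw [← Real.log_mul (by norm_num) (by positivity)]
      exact Real.log_le_log (by positivity) (by linarith)
    have h5 : Real.log 2 ≥ 1 / 2 := by linarith [Real.log_two_gt_d9]
    have h6 : Real.log 2 ≤ 1 := by linarith [Real.log_two_lt_d9]
    rw [hs] at h3
    have h7 : t / 16 ≤ Chebyshev.theta n := by
      have e1 : 2 * t ^ 2 * Real.log n ≤ 2 * t ^ 2 * (1 / 16 * t) := by gcongr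
      have e2 : (n : ℝ) * (1 / 2) ≤ n * Real.log 2 := by gcongr
      have e3 : 4 * t ^ 2 ≤ t ^ 4 := by nlinarith [sq_nonneg t]
      have e4 : 8 * t ≤ t ^ 4 := by nlinarith [sq_nonneg t]
      have e5 : 2 * t ^ 3 ≤ t ^ 4 := by nlinarith [pow_pos ht0 3]
      nlinarith
    calc Real.log n ≤ δ / 16 * t := hb
      _ = δ * (t / 16) := by ring
      _ ≤ _ := by gcongr
  obtain ⟨n₀, hn₀⟩ := Filter.eventually_atTop.1 key
  refine ⟨n₀ + 3, by linarith [(Nat.cast_nonneg n₀ : (0 : ℝ) ≤ n₀)], fun m hm => ?_⟩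
  have hm1 : (1 : ℝ) ≤ m := by exact_mod_cast Nat.one_le_iff_ne_zero.2 hm
  have hmd : (1 : ℝ) ≤ (m : ℝ) ^ δ := Real.one_le_rpow hm1 hδ.le
  set y : ℕ := ⌈(m : ℝ) ^ δ⌉₊ + 1 + n₀ with hy
  have hy1 : (m : ℝ) ^ δ < y := by
    have := Nat.le_ceil ((m : ℝ) ^ δ)
    rw [hy]; push_cast; linarith [(Nat.cast_nonneg n₀ : (0 : ℝ) ≤ n₀)]
  have hy2 : (y : ℝ) ≤ (n₀ + 3) * (m : ℝ) ^ δ := by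
    have := Nat.ceil_lt_add_one (show (0 : ℝ) ≤ (m : ℝ) ^ δ by positivity)
    rw [hy]; push_cast; nlinarith [(Nat.cast_nonneg n₀ : (0 : ℝ) ≤ n₀)]
  by_contra! hcon
  have hdvd : primorial y ∣ m := by
    refine Finset.prod_primes_dvd _ (fun p hp => ?_) (fun p hp => ?_)
    · exact (Finset.mem_filter.1 hp).2.prime
    · obtain ⟨h1, h2⟩ := Finset.mem_filter.1 hp
      by_contra h3
      have := hcon p h2 h3
      have h4 : (p : ℝ) ≤ y := by exact_mod_cast Nat.lt_succ_iff.1 (Finset.mem_range.1 h1)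
      linarith
  have h1 := hn₀ y (by omega)
  rw [Chebyshev.theta_eq_log_primorial, Nat.floor_natCast] at h1
  have h2 : Real.log (primorial y) ≤ Real.log m :=
    Real.log_le_log (by exact_mod_cast primorial_pos y)
      (by exact_mod_cast Nat.le_of_dvd (by omega) hdvd)
  have h3 : Real.log ((m : ℝ) ^ δ) < Real.log y := Real.log_lt_log (by positivity) hy1
  rw [Real.log_rpow (by linarith)] at h3
  nlinarith

theorem exists_card_divisors_le_rpow (ε : ℝ) (hε : 0 < ε) :
    ∃ C : ℝ, 1 ≤ C ∧ ∀ n : ℕ, n ≠ 0 → (n.divisors.card : ℝ) ≤ C * (n : ℝ) ^ ε := by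
  set P : ℕ := ⌈(2 : ℝ) ^ (1 / ε)⌉₊ with hP
  set D : ℝ := 1 + 2 / ε with hD
  have hD1 : 1 ≤ D := by rw [hD]; linarith [show 0 < 2 / ε by positivity]
  refine ⟨D ^ P, one_le_pow₀ hD1, fun n hn => ?_⟩
  have hn' : (n : ℝ) ^ ε = ∏ p ∈ n.primeFactors, ((p : ℝ) ^ ε) ^ n.factorization p := by
    conv_lhs => rw [← Nat.prod_factorization_pow_eq_self hn]
    rw [Finsupp.prod, Nat.support_factorization, Nat.cast_prod,
      ← Real.finsetProd_rpow _ _ (fun _ _ => by positivity)]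
    refine Finset.prod_congr rfl fun p _ => ?_
    rw [Nat.cast_pow, ← Real.rpow_natCast, ← Real.rpow_natCast, ← Real.rpow_mul (by positivity),
      ← Real.rpow_mul (by positivity), mul_comm]
  rw [Nat.card_divisors hn, hn', Nat.cast_prod]
  have hle : ∏ p ∈ n.primeFactors, (if p < P then D else 1) ≤ D ^ P := by
    rw [← Finset.prod_filter, Finset.prod_const]
    refine pow_le_pow_right₀ hD1 ?_
    calc _ ≤ (Finset.range P).card := Finset.card_le_card fun p hp => by
          simpa using (Finset.mem_filter.1 hp).2
      _ = P := by simp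
  refine le_trans ?_ (mul_le_mul_of_nonneg_right hle (Finset.prod_nonneg fun _ _ => by positivity))
  rw [← Finset.prod_mul_distrib]
  refine Finset.prod_le_prod (fun _ _ => by positivity) fun p hp => ?_
  have hp2 : (2 : ℝ) ≤ p := by exact_mod_cast (Nat.prime_of_mem_primeFactors hp).two_le
  set e := n.factorization p
  push_cast
  split_ifs with h
  · have h1 : 1 + (e : ℝ) * ((2 : ℝ) ^ ε - 1) ≤ ((2 : ℝ) ^ ε) ^ e := by
      have := one_add_mul_le_pow (a := (2 : ℝ) ^ ε - 1)
        (by linarith [show 0 < (2 : ℝ) ^ ε by positivity]) e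
      simpa using this
    have h2 : ε / 2 ≤ (2 : ℝ) ^ ε - 1 := by
      rw [Real.rpow_def_of_pos (by norm_num)]
      have := Real.add_one_le_exp (Real.log 2 * ε)
      nlinarith [Real.log_two_gt_d9]
    have h3 : ((2 : ℝ) ^ ε) ^ e ≤ ((p : ℝ) ^ ε) ^ e := by gcongr
    have h4 : 1 + (e : ℝ) * (ε / 2) ≤ ((p : ℝ) ^ ε) ^ e := by
      refine le_trans ?_ (h1.trans h3); gcongr
    calc (e : ℝ) + 1 ≤ D * (1 + e * (ε / 2)) := by
          have h5 : 2 / ε * (ε / 2) = 1 := by field_simp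
          have h6 : 0 ≤ (e : ℝ) * ε := by positivity
          have h7 : 0 ≤ 2 / ε := by positivity
          rw [hD]; linear_combination h7 + h6 / 2 - (e : ℝ) * h5
      _ ≤ _ := by gcongr
  · have h1 : (2 : ℝ) ≤ (p : ℝ) ^ ε := by
      have : (2 : ℝ) ^ (1 / ε) ≤ p := (Nat.le_ceil _).trans (by exact_mod_cast not_lt.1 h)
      calc (2 : ℝ) = ((2 : ℝ) ^ (1 / ε)) ^ ε := by
            rw [← Real.rpow_mul (by norm_num), one_div_mul_cancel hε.ne', Real.rpow_one]
        _ ≤ _ := by gcongr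
    rw [one_mul]
    calc (e : ℝ) + 1 ≤ 2 ^ e := by exact_mod_cast Nat.lt_two_pow_self
      _ ≤ _ := by gcongr

theorem card_roots_mod_prime_le (f : ℤ[X]) (hf : f.content = 1) (p : ℕ) (hp : p.Prime) :
    ((Finset.range p).filter fun ν : ℕ => (p : ℤ) ∣ f.eval (ν : ℤ)).card ≤ f.natDegree := by
  have := Fact.mk hp
  have hne : f.map (Int.castRingHom (ZMod p)) ≠ 0 := by
    intro h
    have h1 : C (p : ℤ) ∣ f := by
      rw [C_dvd_iff_dvd_coeff]
      intro i
      have := congrArg (fun g => coeff g i) h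
      simp only [coeff_map, coeff_zero, eq_intCast] at this
      exact (ZMod.intCast_zmod_eq_zero_iff_dvd _ _).1 this
    have h2 := (Polynomial.isPrimitive_iff_content_eq_one.2 hf) _ h1
    have := Int.isUnit_iff.1 h2
    have := hp.two_le
    omega
  refine le_trans ?_ (natDegree_map_le (f := Int.castRingHom (ZMod p)) (p := f))
  refine le_trans ?_ (Polynomial.card_roots' _)
  refine le_trans ?_ (Multiset.toFinset_card_le _)
  refine Finset.card_le_card_of_injOn (fun ν => (ν : ZMod p)) ?_ ?_
  · intro ν hν
    simp only [Finset.coe_filter, Set.mem_ofPred_eq] at hν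
    have h2 := (ZMod.intCast_zmod_eq_zero_iff_dvd _ _).2 hν.2
    simp only [Finset.mem_coe, Multiset.mem_toFinset, mem_roots hne, IsRoot.def]
    rw [← h2, show ((ν : ℕ) : ZMod p) = Int.castRingHom (ZMod p) (ν : ℤ) by simp,
      eval_map, eval₂_at_apply]
    simp
  · intro ν hν μ hμ h
    simp only [Finset.coe_filter, Set.mem_ofPred_eq, Finset.mem_range] at hν hμ
    have := (ZMod.natCast_eq_natCast_iff' _ _ _).1 h
    rwa [Nat.mod_eq_of_lt hν.1, Nat.mod_eq_of_lt hμ.1] at this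

theorem card_roots_mod_squarefree_le (f : ℤ[X]) (hf : f.content = 1) (s : ℕ) (hs : Squarefree s) :
    ((Finset.range s).filter fun ν : ℕ => (s : ℤ) ∣ f.eval (ν : ℤ)).card
      ≤ f.natDegree ^ s.primeFactors.card := by
  set T := s.primeFactors.pi fun p =>
    (Finset.range p).filter fun ν : ℕ => (p : ℤ) ∣ f.eval (ν : ℤ)
  have hT : T.card ≤ f.natDegree ^ s.primeFactors.card := by
    rw [Finset.card_pi]
    exact Finset.prod_le_pow_card _ _ _ fun p hp =>
      card_roots_mod_prime_le f hf p (Nat.prime_of_mem_primeFactors hp)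
  refine le_trans (Finset.card_le_card_of_injOn (fun ν p _ => ν % p) ?_ ?_) hT
  · intro ν hν
    simp only [Finset.coe_filter, Set.mem_ofPred_eq] at hν
    simp only [T, Finset.mem_coe, Finset.mem_pi, Finset.mem_filter, Finset.mem_range]
    intro p hp
    refine ⟨Nat.mod_lt _ (Nat.prime_of_mem_primeFactors hp).pos, ?_⟩
    have h1 : ((p : ℕ) : ℤ) ∣ f.eval (ν : ℤ) :=
      dvd_trans (by exact_mod_cast Nat.dvd_of_mem_primeFactors hp) hν.2
    have h2 : (p : ℤ) ∣ f.eval (ν : ℤ) - f.eval ((ν % p : ℕ) : ℤ) :=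
      dvd_trans (by push_cast; exact Int.dvd_self_sub_emod) (sub_dvd_eval_sub _ _ f)
    exact (dvd_sub_right h1).1 h2
  · intro ν hν μ hμ h
    simp only [Finset.coe_filter, Set.mem_ofPred_eq, Finset.mem_range] at hν hμ
    have h1 : ((s : ℕ) : ℤ) ∣ (ν : ℤ) - μ := by
      rw [Int.natCast_dvd, ← Nat.prod_primeFactors_of_squarefree hs]
      refine Finset.prod_primes_dvd _ (fun p hp => (Nat.prime_of_mem_primeFactors hp).prime)
        fun p hp => ?_
      rw [← Int.natCast_dvd]
      have h2 : ν % p = μ % p := congrFun (congrFun h p) hp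
      exact (Nat.modEq_iff_dvd.1 (show μ ≡ ν [MOD p] from h2.symm))
    have := Int.eq_zero_of_abs_lt_dvd h1 (by rw [abs_lt]; omega)
    omega

theorem exists_card_roots_mod_squarefree_le (k : ℕ) (ε : ℝ) (hε : 0 < ε) :
    ∃ C : ℝ, 1 ≤ C ∧ ∀ f : ℤ[X], f.natDegree = k → f.content = 1 → ∀ s : ℕ, Squarefree s →
      (((Finset.range s).filter fun ν : ℕ => (s : ℤ) ∣ f.eval (ν : ℤ)).card : ℝ)
        ≤ C * (s : ℝ) ^ ε := by
  obtain ⟨C, hC, h⟩ := exists_card_divisors_le_rpow (ε / (k + 1)) (by positivity)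
  refine ⟨C ^ (k + 1), one_le_pow₀ hC, fun f hk hf s hs => ?_⟩
  have hs0 : s ≠ 0 := hs.ne_zero
  have h1 := card_roots_mod_squarefree_le f hf s hs
  have h2 : f.natDegree ^ s.primeFactors.card ≤ s.divisors.card ^ (k + 1) := by
    calc f.natDegree ^ s.primeFactors.card ≤ (2 ^ (k + 1)) ^ s.primeFactors.card := by
          rw [hk]; gcongr
          exact (Nat.lt_two_pow_self).le.trans (Nat.pow_le_pow_right (by norm_num) (by omega))
      _ = (2 ^ s.primeFactors.card) ^ (k + 1) := by rw [← pow_mul, ← pow_mul, mul_comm]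
      _ ≤ _ := by
          gcongr
          rw [Nat.card_divisors hs0]
          refine Finset.pow_card_le_prod _ _ _ fun p hp => ?_
          have := (Nat.prime_of_mem_primeFactors hp).factorization_pos_of_dvd hs0
            (Nat.dvd_of_mem_primeFactors hp)
          omega
  calc _ ≤ ((s.divisors.card : ℝ)) ^ (k + 1) := by exact_mod_cast h1.trans h2
    _ ≤ (C * (s : ℝ) ^ (ε / (k + 1))) ^ (k + 1) := by gcongr; exact h s hs0
    _ = _ := by
        rw [mul_pow, ← Real.rpow_natCast ((s : ℝ) ^ _), ← Real.rpow_mul (by positivity)]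
        congr 2; push_cast; field_simp

theorem exists_polynomial_sqrt_mod_prime_pow (g : ℤ[X]) (s u₀ v₀ : ℤ) (p : ℕ) (hp : p.Prime)
    (hpv : ¬ (p : ℤ) ∣ 2 * s * v₀) (h₀ : (p : ℤ) ∣ s * v₀ ^ 2 - g.eval u₀) (M : ℕ) :
    ∃ w : ℤ[X], ∀ x : ℤ, (p : ℤ) ∣ x → (p : ℤ) ∣ w.eval x - v₀ ∧
      (p : ℤ) ^ (M + 1) ∣ s * (w.eval x) ^ 2 - g.eval (u₀ + x) := by
  obtain ⟨c, hc⟩ : ∃ c : ℤ, (p : ℤ) ∣ 1 - c * (2 * s * v₀) := by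
    have h1 : IsCoprime (p : ℤ) (2 * s * v₀) :=
      (Nat.prime_iff_prime_int.1 hp).coprime_iff_not_dvd.2 hpv
    obtain ⟨a, b, hab⟩ := h1
    exact ⟨b, a, by linear_combination -hab⟩
  induction M with
  | zero =>
    refine ⟨C v₀, fun x hx => ⟨by simp, ?_⟩⟩
    have h1 : (p : ℤ) ∣ g.eval (u₀ + x) - g.eval u₀ := by
      refine dvd_trans ?_ (sub_dvd_eval_sub _ _ g)
      simpa using hx
    rw [eval_C, zero_add, pow_one]
    have := dvd_sub h₀ h1
    exact this.trans (dvd_of_eq (by ring))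
  | succ M ih =>
    obtain ⟨w, hw⟩ := ih
    refine ⟨w - C c * (C s * w ^ 2 - g.comp (C u₀ + X)), fun x hx => ?_⟩
    obtain ⟨h1, h2⟩ := hw x hx
    simp only [eval_sub, eval_mul, eval_C, eval_pow, eval_comp, eval_add, eval_X]
    set W := w.eval x
    set G := g.eval (u₀ + x)
    obtain ⟨e, he⟩ := h2
    have hpe : (p : ℤ) ∣ s * W ^ 2 - G := by
      rw [he, pow_succ]; exact ⟨p ^ M * e, by ring⟩
    constructor
    · have := dvd_sub h1 (hpe.mul_left c)
      exact this.trans (dvd_of_eq (by ring))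
    · obtain ⟨d, hd⟩ : (p : ℤ) ∣ 1 - 2 * s * c * W := by
        obtain ⟨a, ha⟩ := hc
        obtain ⟨b, hb⟩ := h1
        exact ⟨a - 2 * s * c * b, by linear_combination ha - 2 * s * c * hb⟩
      refine ⟨e * d + s * c ^ 2 * e ^ 2 * p ^ M, ?_⟩
      linear_combination (1 - 2 * s * c * W) * he + (p : ℤ) ^ (M + 1) * e * hd
        + s * c ^ 2 * (s * W ^ 2 - G + (p : ℤ) ^ (M + 1) * e) * he

theorem dvd_eval_of_forall_pow_dvd_coeff (P : ℤ[X]) (q : ℤ) (E : ℕ)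
    (h : ∀ m < E, q ^ (E - m) ∣ P.coeff m) (x : ℤ) (hx : q ∣ x) : q ^ E ∣ P.eval x := by
  rw [eval_eq_sum_range]
  refine Finset.dvd_sum fun m _ => ?_
  rcases lt_or_ge m E with hm | hm
  · rw [show q ^ E = q ^ (E - m) * q ^ m by rw [← pow_add, Nat.sub_add_cancel hm.le]]
    exact mul_dvd_mul (h m hm) (pow_dvd_pow_of_dvd hx m)
  · exact (dvd_trans (pow_dvd_pow q hm) (pow_dvd_pow_of_dvd hx m)).mul_left _

theorem prod_range_mul_const (U R l : ℕ) :
    (∏ i : Fin (l + 1), (U ^ (l - (i : ℕ)) * R)) ^ 2 = (U ^ l * R ^ 2) ^ (l + 1) := by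
  rw [Fin.prod_univ_eq_prod_range (fun i => U ^ (l - i) * R), Finset.prod_mul_distrib,
    Finset.prod_pow_eq_pow_sum, Finset.prod_const, Finset.card_range]
  have h : (∑ i ∈ Finset.range (l + 1), (l - i)) * 2 = (l + 1) * l := by
    have := Finset.sum_range_reflect (fun i => i) (l + 1)
    simp only [Nat.add_sub_cancel] at this
    have h2 := Finset.sum_range_id_mul_two (l + 1)
    rw [← this] at h2
    simpa [Nat.sub_sub, add_comm] using h2
  rw [mul_pow, ← pow_mul, h, mul_pow, ← pow_mul, ← pow_mul, ← pow_mul]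
  ring_nf

theorem prod_pow_sub (q l : ℕ) :
    ∏ m : Fin (2 * l + 1), q ^ (2 * l + 1 - (m : ℕ)) = (q ^ (2 * l + 1)) ^ (l + 1) := by
  rw [Fin.prod_univ_eq_prod_range (fun m => q ^ (2 * l + 1 - m)), Finset.prod_pow_eq_pow_sum,
    ← pow_mul]
  congr 1
  have := Finset.sum_range_reflect (fun i => i + 1) (2 * l + 1)
  have h3 : ∀ j ∈ Finset.range (2 * l + 1), 2 * l + 1 - j = 2 * l + 1 - 1 - j + 1 := by
    intro j hj; have := Finset.mem_range.1 hj; omega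
  rw [Finset.sum_congr rfl h3, this]
  have h2 := Finset.sum_range_id_mul_two (2 * l + 1)
  rw [Finset.sum_add_distrib, Finset.sum_const, Finset.card_range, smul_eq_mul, mul_one]
  simp only [Nat.add_sub_cancel] at h2
  nlinarith

/-- Pigeonhole construction of a small integer vector making a polynomial combination vanish to
high order modulo powers of `q`. -/
theorem exists_small_combination (w : ℤ[X]) (u₀ : ℤ) (q U R l : ℕ) (hq : 0 < q)
    (hR : q ^ (2 * l + 1) < U ^ l * R ^ 2) :
    ∃ a b : Fin (l + 1) → ℤ, (a, b) ≠ 0 ∧ (∀ i, |a i| < U ^ (l - (i : ℕ)) * R) ∧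
      (∀ i, |b i| < U ^ (l - (i : ℕ)) * R) ∧
      ∀ m < 2 * l + 1, (q : ℤ) ^ (2 * l + 1 - m) ∣
        ((∑ i, C (a i) * X ^ (i : ℕ)).comp (X + C u₀) +
          (∑ i, C (b i) * X ^ (i : ℕ)).comp (X + C u₀) * w).coeff m := by
  set B : Finset (Fin (l + 1) → ℤ) :=
    Fintype.piFinset fun i => Finset.Ico 0 ((U ^ (l - (i : ℕ)) * R : ℕ) : ℤ) with hB
  set T : Finset (Fin (2 * l + 1) → ℤ) :=
    Fintype.piFinset fun m => Finset.Ico 0 ((q ^ (2 * l + 1 - (m : ℕ)) : ℕ) : ℤ) with hT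
  set Φ : (Fin (l + 1) → ℤ) × (Fin (l + 1) → ℤ) → ℤ[X] := fun c =>
    (∑ i, C (c.1 i) * X ^ (i : ℕ)).comp (X + C u₀) +
          (∑ i, C (c.2 i) * X ^ (i : ℕ)).comp (X + C u₀) * w with hΦ
  have hcard : T.card < (B ×ˢ B).card := by
    rw [Finset.card_product, hB, hT, Fintype.card_piFinset, Fintype.card_piFinset]
    simp only [Int.card_Ico, sub_zero, Int.toNat_natCast]
    rw [← sq, prod_range_mul_const, prod_pow_sub]
    exact Nat.pow_lt_pow_left hR (by omega)
  obtain ⟨c, hc, d, hd, hcd, heq⟩ := Finset.exists_ne_map_eq_of_card_lt_of_maps_to hcard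
    (f := fun c => fun m : Fin (2 * l + 1) =>
      (Φ c).coeff m % ((q ^ (2 * l + 1 - (m : ℕ)) : ℕ) : ℤ)) (by
    intro c _
    simp only [hT, Finset.mem_coe, Fintype.mem_piFinset, Finset.mem_Ico]
    intro m
    have : (0 : ℤ) < ((q ^ (2 * l + 1 - (m : ℕ)) : ℕ) : ℤ) := by positivity
    exact ⟨Int.emod_nonneg _ this.ne', Int.emod_lt_of_pos _ this⟩)
  simp only [Finset.mem_product, hB, Fintype.mem_piFinset, Finset.mem_Ico] at hc hd
  push_cast at hc hd
  refine ⟨fun i => c.1 i - d.1 i, fun i => c.2 i - d.2 i, ?_, ?_, ?_, ?_⟩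
  · intro h
    apply hcd
    have h1 := (Prod.mk.inj h)
    ext i
    · exact sub_eq_zero.1 (congrFun h1.1 i)
    · exact sub_eq_zero.1 (congrFun h1.2 i)
  · intro i; rw [abs_lt]; have := hc.1 i; have := hd.1 i; constructor <;> linarith
  · intro i; rw [abs_lt]; have := hc.2 i; have := hd.2 i; constructor <;> linarith
  · intro m hm
    have h1 := congrFun heq ⟨m, hm⟩
    have h2 := Int.ModEq.dvd (show (Φ d).coeff m ≡ (Φ c).coeff m [ZMOD _] from h1.symm)
    rw [← coeff_sub] at h2
    push_cast at h2
    convert h2 using 2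
    congr 1
    simp only [hΦ, C_sub, sub_mul, Finset.sum_sub_distrib, sub_comp]
    ring

theorem abs_combination_lt (l U R V : ℕ) (a b : Fin (l + 1) → ℤ)
    (ha : ∀ i, |a i| < U ^ (l - (i : ℕ)) * R) (hb : ∀ i, |b i| < U ^ (l - (i : ℕ)) * R)
    (hU : 0 < U) (u v : ℤ) (hu : |u| ≤ U) (hv : |v| ≤ V) :
    |∑ i, a i * u ^ (i : ℕ) + (∑ i, b i * u ^ (i : ℕ)) * v| <
      (l + 1) * (R * U ^ l * (1 + V)) := by
  have key : ∀ c : Fin (l + 1) → ℤ, (∀ i, |c i| < U ^ (l - (i : ℕ)) * R) →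
      |∑ i, c i * u ^ (i : ℕ)| < (l + 1) * (R * U ^ l) := by
    intro c hc
    calc |∑ i, c i * u ^ (i : ℕ)| ≤ ∑ i, |c i * u ^ (i : ℕ)| := Finset.abs_sum_le_sum_abs _ _
      _ < ∑ i : Fin (l + 1), ((R * U ^ l : ℕ) : ℤ) := by
          refine Finset.sum_lt_sum_of_nonempty Finset.univ_nonempty fun i _ => ?_
          rw [abs_mul, abs_pow]
          calc |c i| * |u| ^ (i : ℕ) ≤ |c i| * (U : ℤ) ^ (i : ℕ) := by gcongr
            _ < (U ^ (l - (i : ℕ)) * R) * (U : ℤ) ^ (i : ℕ) := by gcongr; exact hc i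
            _ = R * (U ^ (l - (i : ℕ)) * (U : ℤ) ^ (i : ℕ)) := by ring
            _ = _ := by
              rw [← pow_add, Nat.sub_add_cancel (Nat.lt_succ_iff.1 i.2)]; push_cast; ring
      _ = _ := by simp
  have h1 := key a ha
  have h2 := key b hb
  calc _ ≤ |∑ i, a i * u ^ (i : ℕ)| + |∑ i, b i * u ^ (i : ℕ)| * |v| := by
        rw [← abs_mul]; exact abs_add_le _ _
    _ ≤ |∑ i, a i * u ^ (i : ℕ)| + (l + 1) * (R * U ^ l) * V := by gcongr
    _ < (l + 1) * (R * U ^ l) + (l + 1) * (R * U ^ l) * V := by gcongr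
    _ = _ := by ring

theorem exists_auxiliary_polynomials (g : ℤ[X]) (s u₀ v₀ : ℤ) (p a l U R V : ℕ) (hp : p.Prime)
    (hpv : ¬ (p : ℤ) ∣ 2 * s * v₀) (h₀ : s * v₀ ^ 2 = g.eval u₀) (ha : 0 < a) (hU : 0 < U)
    (hR : (p ^ a) ^ (2 * l + 1) < U ^ l * R ^ 2)
    (hV : (l + 1) * (R * U ^ l * (1 + V)) ≤ (p ^ a) ^ (2 * l + 1)) :
    ∃ A B : ℤ[X], (A ≠ 0 ∨ B ≠ 0) ∧ A.natDegree ≤ l ∧ B.natDegree ≤ l ∧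
      ∀ u v : ℤ, |u| ≤ U → |v| ≤ V → ((p ^ a : ℕ) : ℤ) ∣ u - u₀ → (p : ℤ) ∣ v - v₀ →
        s * v ^ 2 = g.eval u → A.eval u + B.eval u * v = 0 := by
  obtain ⟨w, hw⟩ := exists_polynomial_sqrt_mod_prime_pow g s u₀ v₀ p hp hpv (by simp [h₀])
    (a * (2 * l + 1))
  obtain ⟨c, d, hne, hc, hd, hcd⟩ := exists_small_combination w u₀ (p ^ a) U R l
    (pow_pos hp.pos _) hR
  have hcoeff : ∀ (e : Fin (l + 1) → ℤ) (i : Fin (l + 1)),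
      (∑ i, C (e i) * X ^ (i : ℕ) : ℤ[X]).coeff i = e i := by
    intro e i
    simp [coeff_X_pow, Fin.val_inj]
  have hdeg : ∀ e : Fin (l + 1) → ℤ, (∑ i, C (e i) * X ^ (i : ℕ) : ℤ[X]).natDegree ≤ l := by
    intro e
    refine natDegree_sum_le_of_forall_le _ _ fun i _ => ?_
    exact (natDegree_C_mul_X_pow_le _ _).trans (Nat.lt_succ_iff.1 i.2)
  refine ⟨∑ i, C (c i) * X ^ (i : ℕ), ∑ i, C (d i) * X ^ (i : ℕ), ?_, hdeg c, hdeg d, ?_⟩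
  · by_contra! h
    apply hne
    ext i
    · have h1 := hcoeff c i
      rw [h.1, coeff_zero] at h1
      exact h1.symm
    · have h1 := hcoeff d i
      rw [h.2, coeff_zero] at h1
      exact h1.symm
  · intro u v hu hv hqu hpv' hsv
    have hlt := abs_combination_lt l U R V c d hc hd hU u v hu hv
    have hpu : (p : ℤ) ∣ u - u₀ := by
      refine dvd_trans ?_ hqu
      push_cast
      exact dvd_pow_self _ ha.ne'
    obtain ⟨h1, h2⟩ := hw (u - u₀) hpu
    set W := w.eval (u - u₀) with hW
    rw [add_sub_cancel, ← hsv] at h2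
    have h3 : (p : ℤ) ^ (a * (2 * l + 1)) ∣ W - v := by
      have h4 : (p : ℤ) ^ (a * (2 * l + 1)) ∣ (s * (W + v)) * (W - v) := by
        refine dvd_trans (pow_dvd_pow _ (Nat.le_succ _)) ?_
        exact h2.trans (dvd_of_eq (by ring))
      refine IsCoprime.dvd_of_dvd_mul_left (IsCoprime.pow_left ?_) h4
      refine (Nat.prime_iff_prime_int.1 hp).coprime_iff_not_dvd.2 fun h5 => hpv ?_
      have := (h5.sub (h1.mul_left s)).sub (hpv'.mul_left s)
      exact this.trans (dvd_of_eq (by ring))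
    have h5 := dvd_eval_of_forall_pow_dvd_coeff _ _ _ hcd _ hqu
    have hz : ∀ e : Fin (l + 1) → ℤ, (∑ i, C (e i) * X ^ (i : ℕ) : ℤ[X]).eval u
        = ∑ i, e i * u ^ (i : ℕ) := by
      intro e; simp [eval_finsetSum]
    simp only [eval_add, eval_mul, eval_comp, eval_X, eval_C, sub_add_cancel] at h5
    rw [hz, hz, ← hW] at h5
    rw [hz, hz]
    have h6 : (((p ^ a : ℕ) : ℤ)) ^ (2 * l + 1) ∣
        ∑ i, c i * u ^ (i : ℕ) + (∑ i, d i * u ^ (i : ℕ)) * v := by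
      have h7 : (((p ^ a : ℕ) : ℤ)) ^ (2 * l + 1) ∣ W - v := by
        rw [Nat.cast_pow, ← pow_mul]; exact h3
      have := h5.sub (h7.mul_left (∑ i, d i * u ^ (i : ℕ)))
      exact this.trans (dvd_of_eq (by ring))
    refine Int.eq_zero_of_abs_lt_dvd h6 (hlt.trans_le ?_)
    exact_mod_cast hV

theorem sq_mul_ne_sq_mul (g : ℤ[X]) (hg : Irreducible (g.map (Int.castRingHom ℚ))) (s : ℤ)
    (hs : s ≠ 0) (A B : ℤ[X]) (hAB : A ≠ 0 ∨ B ≠ 0) : C s * A ^ 2 - B ^ 2 * g ≠ 0 := by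
  intro h
  have hinj : Function.Injective (Int.castRingHom ℚ) := Int.cast_injective
  have h1 := congrArg (Polynomial.map (Int.castRingHom ℚ)) (sub_eq_zero.1 h)
  simp only [Polynomial.map_mul, Polynomial.map_pow, map_C] at h1
  set G := g.map (Int.castRingHom ℚ)
  set α := A.map (Int.castRingHom ℚ) with hα
  set β := B.map (Int.castRingHom ℚ) with hβ
  have hsu : IsUnit (C ((Int.castRingHom ℚ) s)) := by
    rw [isUnit_C, isUnit_iff_ne_zero]; simpa using hs
  have hA : A ≠ 0 → α ≠ 0 := fun hA => (Polynomial.map_ne_zero_iff hinj).2 hA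
  have hB : B ≠ 0 → β ≠ 0 := fun hB => (Polynomial.map_ne_zero_iff hinj).2 hB
  have hα0 : α ≠ 0 := by
    rcases hAB with h2 | h2
    · exact hA h2
    · intro h3
      rw [h3] at h1
      have : β ^ 2 * G ≠ 0 := mul_ne_zero (pow_ne_zero _ (hB h2)) hg.ne_zero
      exact this (by rw [← h1]; ring)
  have hβ0 : β ≠ 0 := by
    intro h3
    rw [h3] at h1
    have : C ((Int.castRingHom ℚ) s) * α ^ 2 ≠ 0 := mul_ne_zero hsu.ne_zero (pow_ne_zero _ hα0)
    exact this (by rw [h1]; ring)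
  have h2 := congrArg (emultiplicity G) h1
  rw [emultiplicity_mul hg.prime, emultiplicity_mul hg.prime, emultiplicity_pow hg.prime,
    emultiplicity_pow hg.prime, emultiplicity_of_isUnit_right hg.not_isUnit hsu,
    (FiniteMultiplicity.of_not_isUnit hg.not_isUnit hα0).emultiplicity_eq_multiplicity,
    (FiniteMultiplicity.of_not_isUnit hg.not_isUnit hβ0).emultiplicity_eq_multiplicity,
    (FiniteMultiplicity.of_not_isUnit hg.not_isUnit hg.ne_zero).emultiplicity_self] at h2
  norm_cast at h2
  omega

open Classical in
/-- The natural numbers `u ≤ U` lying below a point `(u, v)` of `s v ^ 2 = g(u)` with `|v| ≤ V` at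
which the reduction modulo `p` is unramified over the `u`-line. -/
noncomputable def unramifiedPoints (g : ℤ[X]) (s : ℤ) (p U V : ℕ) : Finset ℕ :=
  (Finset.range (U + 1)).filter fun u =>
    ∃ v : ℤ, |v| ≤ V ∧ s * v ^ 2 = g.eval (u : ℤ) ∧ ¬ (p : ℤ) ∣ 2 * s * v

theorem card_unramifiedPoints_le (g : ℤ[X]) (hg : Irreducible (g.map (Int.castRingHom ℚ))) (s : ℤ)
    (hs : s ≠ 0) (p a l U R V : ℕ) (hp : p.Prime) (ha : 0 < a) (hU : 0 < U)
    (hR : (p ^ a) ^ (2 * l + 1) < U ^ l * R ^ 2)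
    (hV : (l + 1) * (R * U ^ l * (1 + V)) ≤ (p ^ a) ^ (2 * l + 1)) :
    (unramifiedPoints g s p U V).card ≤ (2 * l + g.natDegree) * (p ^ a * p) := by
  classical
  have hex : ∀ u : ℕ, ∃ v : ℤ, u ∈ unramifiedPoints g s p U V →
      |v| ≤ V ∧ s * v ^ 2 = g.eval (u : ℤ) ∧ ¬ (p : ℤ) ∣ 2 * s * v := by
    intro u
    by_cases h : u ∈ unramifiedPoints g s p U V
    · obtain ⟨v, hv⟩ := (Finset.mem_filter.1 h).2
      exact ⟨v, fun _ => hv⟩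
    · exact ⟨0, fun h' => absurd h' h⟩
  choose v hv using hex
  have hp0 : (0 : ℤ) < p := by exact_mod_cast hp.pos
  have hcard : (Finset.range (p ^ a) ×ˢ Finset.Ico (0 : ℤ) p).card = p ^ a * p := by simp
  rw [← hcard]
  refine Finset.card_le_mul_card_image_of_maps_to
    (f := fun u : ℕ => (u % p ^ a, v u % (p : ℤ))) ?_ _ ?_
  · intro u _
    simp only [Finset.mem_product, Finset.mem_range, Finset.mem_Ico]
    exact ⟨Nat.mod_lt _ (pow_pos hp.pos _), Int.emod_nonneg _ hp0.ne', Int.emod_lt_of_pos _ hp0⟩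
  · rintro ⟨b, c⟩ -
    set F := (unramifiedPoints g s p U V).filter fun u => (u % p ^ a, v u % (p : ℤ)) = (b, c)
      with hF
    rcases F.eq_empty_or_nonempty with h0 | ⟨u₀, hu₀⟩
    · rw [h0]; simp
    obtain ⟨hu₀, hbc⟩ := Finset.mem_filter.1 hu₀
    obtain ⟨h1, h2, h3⟩ := hv u₀ hu₀
    obtain ⟨A, B, hAB, hA, hB, h⟩ :=
      exists_auxiliary_polynomials g s u₀ (v u₀) p a l U R V hp h3 h2 ha hU hR hV
    have hne := sq_mul_ne_sq_mul g hg s hs A B hAB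
    set Q := C s * A ^ 2 - B ^ 2 * g with hQ
    have hdeg : Q.natDegree ≤ 2 * l + g.natDegree := by
      refine (natDegree_sub_le _ _).trans (max_le ?_ ?_)
      · refine (natDegree_C_mul_le _ _).trans (natDegree_pow_le.trans ?_)
        nlinarith
      · refine natDegree_mul_le.trans (Nat.add_le_add_right (natDegree_pow_le.trans ?_) _)
        nlinarith
    refine le_trans ?_ hdeg
    refine le_trans ?_ (Q.card_roots')
    refine le_trans ?_ (Multiset.toFinset_card_le _)
    refine Finset.card_le_card_of_injOn (fun u : ℕ => (u : ℤ)) ?_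
      (fun x _ y _ hxy => Nat.cast_injective hxy)
    intro u hu
    obtain ⟨hu, hbc'⟩ := Finset.mem_filter.1 hu
    obtain ⟨h4, h5, h6⟩ := hv u hu
    have hmod := Prod.mk.inj (hbc.trans hbc'.symm)
    have huU : u ≤ U := Nat.lt_succ_iff.1 (Finset.mem_range.1 (Finset.mem_filter.1 hu).1)
    have h7 := h u (v u) (by rw [abs_of_nonneg (by positivity)]; exact_mod_cast huU) h4
      (Nat.modEq_iff_dvd.1 hmod.1) (Int.ModEq.dvd hmod.2) h5
    rw [Finset.mem_coe, Multiset.mem_toFinset, mem_roots hne, IsRoot.def, hQ, eval_sub, eval_mul,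
      eval_mul, eval_C, eval_pow, eval_pow, ← h5]
    linear_combination s * (A.eval (u : ℤ) - B.eval (u : ℤ) * v u) * h7

theorem card_unramifiedPoints_le_rpow (g : ℤ[X]) (hg : Irreducible (g.map (Int.castRingHom ℚ)))
    (s : ℤ) (hs : s ≠ 0) (p l U V : ℕ) (hp : p.Prime) (hU : 0 < U) :
    ((unramifiedPoints g s p U V).card : ℝ) ≤ (2 * l + g.natDegree) *
      ((p : ℝ) ^ 2 * ((4 * (l + 1) ^ 2 * (1 + V) ^ 2 * U ^ l : ℕ) : ℝ) ^ (1 / (2 * l + 1 : ℝ))) := by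
  set T := 4 * (l + 1) ^ 2 * (1 + V) ^ 2 * U ^ l with hT
  have hTpos : 0 < T := by positivity
  have hex : ∃ a, T < (p ^ a) ^ (2 * l + 1) := by
    refine ⟨T, ?_⟩
    calc T < p ^ T := Nat.lt_pow_self hp.one_lt
      _ ≤ (p ^ T) ^ (2 * l + 1) := Nat.le_self_pow (by omega) _
  classical
  obtain ⟨a, ha, hmin⟩ : ∃ a, T < (p ^ a) ^ (2 * l + 1) ∧ ∀ b < a, (p ^ b) ^ (2 * l + 1) ≤ T :=
    ⟨Nat.find hex, Nat.find_spec hex, fun b hb => not_lt.1 (Nat.find_min hex hb)⟩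
  have ha0 : 0 < a := by
    rcases Nat.eq_zero_or_pos a with h | h
    · rw [h] at ha; simp at ha; omega
    · exact h
  set q := p ^ a with hq
  have hUl : 0 < U ^ l := pow_pos hU _
  set Z := q ^ (2 * l + 1) / U ^ l with hZ
  have hZU : Z * U ^ l ≤ q ^ (2 * l + 1) := Nat.div_mul_le_self _ _
  have hZ1 : 1 ≤ Z := by
    rw [hZ, Nat.one_le_div_iff hUl]
    refine le_trans ?_ ha.le
    rw [hT]
    exact Nat.le_mul_of_pos_left _ (by positivity)
  have hR : q ^ (2 * l + 1) < U ^ l * (Nat.sqrt Z + 1) ^ 2 := by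
    have := Nat.lt_succ_sqrt' Z
    rw [hZ, Nat.div_lt_iff_lt_mul hUl] at this
    rw [mul_comm (U ^ l)]; exact this
  have hV : (l + 1) * ((Nat.sqrt Z + 1) * U ^ l * (1 + V)) ≤ q ^ (2 * l + 1) := by
    have h1 : (Nat.sqrt Z + 1) ^ 2 ≤ 4 * Z := by
      have h2 := Nat.sqrt_le' Z
      have h3 : 1 ≤ Nat.sqrt Z := Nat.sqrt_pos.2 hZ1
      nlinarith
    rw [← Nat.pow_le_pow_iff_left two_ne_zero]
    calc ((l + 1) * ((Nat.sqrt Z + 1) * U ^ l * (1 + V))) ^ 2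
        = (l + 1) ^ 2 * (1 + V) ^ 2 * U ^ l * (((Nat.sqrt Z + 1) ^ 2) * U ^ l) := by ring
      _ ≤ (l + 1) ^ 2 * (1 + V) ^ 2 * U ^ l * (4 * Z * U ^ l) := by gcongr
      _ = T * (Z * U ^ l) := by rw [hT]; ring
      _ ≤ q ^ (2 * l + 1) * q ^ (2 * l + 1) := Nat.mul_le_mul ha.le hZU
      _ = _ := by ring
  have h := card_unramifiedPoints_le g hg s hs p a l U _ V hp ha0 hU hR hV
  have h1 : ((p : ℝ) ^ (a - 1)) ≤ (T : ℝ) ^ (1 / (2 * l + 1 : ℝ)) := by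
    have h2 : (((p : ℝ) ^ (a - 1)) ^ (2 * l + 1)) ≤ T := by
      exact_mod_cast hmin (a - 1) (by omega)
    calc ((p : ℝ) ^ (a - 1)) = ((((p : ℝ) ^ (a - 1)) ^ (2 * l + 1))) ^ (1 / (2 * l + 1 : ℝ)) := by
          rw [← Real.rpow_natCast _ (2 * l + 1), ← Real.rpow_mul (by positivity)]
          push_cast
          rw [mul_one_div_cancel (by positivity), Real.rpow_one]
      _ ≤ _ := by gcongr
  calc ((unramifiedPoints g s p U V).card : ℝ) ≤ (2 * l + g.natDegree) * ((p : ℝ) ^ a * p) := by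
        exact_mod_cast h
    _ = (2 * l + g.natDegree) * ((p : ℝ) ^ 2 * (p : ℝ) ^ (a - 1)) := by
        congr 1
        rw [← pow_succ, ← pow_add]; congr 1; omega
    _ ≤ _ := by gcongr

theorem eval_ne_zero_of_irreducible_map (g : ℤ[X]) (hg : Irreducible (g.map (Int.castRingHom ℚ)))
    (hdeg : 2 ≤ g.natDegree) (x : ℤ) : g.eval x ≠ 0 := by
  intro h
  have h1 : (g.map (Int.castRingHom ℚ)).IsRoot (x : ℚ) := by
    rw [IsRoot.def, show (x : ℚ) = Int.castRingHom ℚ x by simp, eval_map, eval₂_at_apply, h]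
    simp
  have h2 := degree_eq_one_of_irreducible_of_root hg h1
  have h3 : (g.map (Int.castRingHom ℚ)).natDegree = 1 := natDegree_eq_of_degree_eq_some h2
  rw [natDegree_map_eq_of_injective (RingHom.injective_int _)] at h3
  omega

open Classical in
/-- Square-root saving for the number of integers in an interval at which an irreducible
polynomial takes a value of the form `s v ^ 2`, uniformly in the polynomial. -/
theorem exists_card_eq_mul_sq_le (k : ℕ) (hk : 2 ≤ k) (ε : ℝ) (hε : 0 < ε) :
    ∃ C : ℝ, 1 ≤ C ∧ ∀ (g : ℤ[X]) (s U W : ℕ), g.natDegree = k →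
      Irreducible (g.map (Int.castRingHom ℚ)) → 1 ≤ s → 1 ≤ U → s ≤ W →
      (∀ u : ℕ, u ≤ U → |g.eval (u : ℤ)| ≤ W) →
      (((Finset.range (U + 1)).filter fun u : ℕ => ∃ v : ℤ, g.eval (u : ℤ) = s * v ^ 2).card : ℝ)
        ≤ C * √U * (W : ℝ) ^ ε := by
  obtain ⟨D, hD, hprime⟩ := exists_forall_prime_not_dvd (ε / 12) (by positivity)
  set l : ℕ := ⌈2 / ε⌉₊ with hl
  have hl1 : 2 / ε ≤ l := Nat.le_ceil _
  have hl0 : (0 : ℝ) < l := lt_of_lt_of_le (by positivity) hl1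
  set K : ℝ := D * 2 ^ (ε / 12) with hK
  have hK1 : 1 ≤ K := by
    have : (1 : ℝ) ≤ 2 ^ (ε / 12) := Real.one_le_rpow (by norm_num) (by positivity)
    nlinarith
  refine ⟨2 * K ^ 3 * (2 * l + k) * (16 * (l + 1) ^ 2), ?_, ?_⟩
  · have h1 : (1 : ℝ) ≤ K ^ 3 := one_le_pow₀ hK1
    have h2 : (1 : ℝ) ≤ 2 * l + k := by
      have : (2 : ℝ) ≤ k := by exact_mod_cast hk
      linarith
    have h3 : (1 : ℝ) ≤ 16 * (l + 1) ^ 2 := by nlinarith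
    have h4 : (1 : ℝ) ≤ 2 * K ^ 3 := by linarith
    exact one_le_mul_of_one_le_of_one_le (one_le_mul_of_one_le_of_one_le h4 h2) h3
  intro g s U W hgk hg hs hU hsW hgW
  have hW1 : 1 ≤ W := hs.trans hsW
  have hW1' : (1 : ℝ) ≤ W := by exact_mod_cast hW1
  have hU1' : (1 : ℝ) ≤ U := by exact_mod_cast hU
  set Y : ℝ := K * (W : ℝ) ^ (ε / 6) with hY
  have hWY : (1 : ℝ) ≤ (W : ℝ) ^ (ε / 6) := Real.one_le_rpow hW1' (by positivity)
  have hY1 : 1 ≤ Y := one_le_mul_of_one_le_of_one_le hK1 hWY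
  set θ : ℝ := 1 / (2 * l + 1 : ℝ) with hθ
  have hθ0 : 0 < θ := by positivity
  set T : ℕ := 4 * (l + 1) ^ 2 * (1 + W) ^ 2 * U ^ l with hT
  set bound : ℝ := (2 * l + k) * (Y ^ 2 * (T : ℝ) ^ θ) with hbound
  have hsub : ((Finset.range (U + 1)).filter fun u : ℕ => ∃ v : ℤ, g.eval (u : ℤ) = s * v ^ 2) ⊆
      (((Finset.range (⌊Y⌋₊ + 1)).filter Nat.Prime).biUnion
        fun p => unramifiedPoints g s p U W) := by
    intro u hu
    obtain ⟨huU, v, hv⟩ := Finset.mem_filter.1 hu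
    have hv0 : v ≠ 0 := by
      rintro rfl
      exact eval_ne_zero_of_irreducible_map g hg (by omega) u (by simpa using hv)
    have hvW : |v| ≤ W := by
      have h1 := hgW u (Nat.lt_succ_iff.1 (Finset.mem_range.1 huU))
      rw [hv, abs_mul, abs_pow, Nat.abs_cast] at h1
      have h2 : (1 : ℤ) ≤ s := by exact_mod_cast hs
      have h3 : 1 ≤ |v| := Int.one_le_abs hv0
      nlinarith
    have hm : (2 * (s : ℤ) * v).natAbs ≠ 0 := by
      rw [Int.natAbs_ne_zero]
      have : (s : ℤ) ≠ 0 := by exact_mod_cast (by omega : s ≠ 0)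
      positivity
    obtain ⟨p, hp, hpd, hpY⟩ := hprime _ hm
    have hmW : (((2 * (s : ℤ) * v).natAbs : ℕ) : ℝ) ≤ 2 * (W : ℝ) ^ 2 := by
      have h1 : (2 * (s : ℤ) * v).natAbs ≤ 2 * W * W := by
        rw [Int.natAbs_mul, Int.natAbs_mul]
        have : v.natAbs ≤ W := by exact_mod_cast (Int.natCast_natAbs v).trans_le hvW
        simp only [Int.natAbs_natCast]
        exact Nat.mul_le_mul (Nat.mul_le_mul (by norm_num) hsW) this
      calc _ ≤ ((2 * W * W : ℕ) : ℝ) := by exact_mod_cast h1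
        _ = _ := by push_cast; ring
    have hpY' : (p : ℝ) ≤ Y := by
      refine hpY.trans ?_
      calc _ ≤ D * (2 * (W : ℝ) ^ 2) ^ (ε / 12) := by gcongr
        _ = Y := by
          rw [Real.mul_rpow (by norm_num) (by positivity), ← Real.rpow_natCast (W : ℝ) 2,
            ← Real.rpow_mul (by positivity), hY, hK, mul_assoc]
          congr 3; push_cast; ring
    refine Finset.mem_biUnion.2 ⟨p, Finset.mem_filter.2 ⟨?_, hp⟩, ?_⟩
    · exact Finset.mem_range.2 (Nat.lt_succ_iff.2 (Nat.le_floor hpY'))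
    · exact Finset.mem_filter.2 ⟨huU, v, hvW, hv.symm, fun h => hpd (Int.natCast_dvd.1 h)⟩
  have hTθ : (T : ℝ) ^ θ ≤ 16 * (l + 1) ^ 2 * (W : ℝ) ^ (ε / 2) * √U := by
    have h1 : (T : ℝ) ≤ 16 * (l + 1) ^ 2 * (W : ℝ) ^ 2 * (U : ℝ) ^ l := by
      rw [hT]; push_cast
      have : (1 + (W : ℝ)) ^ 2 ≤ (2 * W) ^ 2 := by gcongr; linarith
      calc 4 * ((l : ℝ) + 1) ^ 2 * (1 + (W : ℝ)) ^ 2 * (U : ℝ) ^ l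
          ≤ 4 * ((l : ℝ) + 1) ^ 2 * (2 * W) ^ 2 * (U : ℝ) ^ l := by gcongr
        _ = _ := by ring
    have hθ1 : θ ≤ 1 := by rw [hθ, div_le_one (by positivity)]; linarith
    have e1 : (16 * ((l : ℝ) + 1) ^ 2) ^ θ ≤ 16 * (l + 1) ^ 2 :=
      Real.rpow_le_self_of_one_le (by nlinarith) hθ1
    have e2 : ((W : ℝ) ^ 2) ^ θ ≤ (W : ℝ) ^ (ε / 2) := by
      rw [← Real.rpow_natCast (W : ℝ) 2, ← Real.rpow_mul (by positivity)]
      refine Real.rpow_le_rpow_of_exponent_le hW1' ?_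
      rw [hθ, Nat.cast_ofNat, mul_one_div, div_le_iff₀ (by positivity)]
      have : 2 ≤ l * ε := (div_le_iff₀ hε).1 hl1
      nlinarith
    have e3 : ((U : ℝ) ^ l) ^ θ ≤ √U := by
      rw [← Real.rpow_natCast (U : ℝ) l, ← Real.rpow_mul (by positivity), Real.sqrt_eq_rpow]
      refine Real.rpow_le_rpow_of_exponent_le hU1' ?_
      rw [hθ, mul_one_div, div_le_iff₀ (by positivity)]
      linarith
    calc (T : ℝ) ^ θ ≤ (16 * (l + 1) ^ 2 * (W : ℝ) ^ 2 * (U : ℝ) ^ l) ^ θ := by gcongr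
      _ = (16 * ((l : ℝ) + 1) ^ 2) ^ θ * ((W : ℝ) ^ 2) ^ θ * ((U : ℝ) ^ l) ^ θ := by
          rw [Real.mul_rpow (by positivity) (by positivity),
            Real.mul_rpow (by positivity) (by positivity)]
      _ ≤ _ := by gcongr
  calc _ ≤ ((((Finset.range (⌊Y⌋₊ + 1)).filter Nat.Prime).biUnion
        fun p => unramifiedPoints g s p U W).card : ℝ) := by
        exact_mod_cast Finset.card_le_card hsub
    _ ≤ ∑ p ∈ (Finset.range (⌊Y⌋₊ + 1)).filter Nat.Prime,
          ((unramifiedPoints g s p U W).card : ℝ) := by exact_mod_cast Finset.card_biUnion_le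
    _ ≤ ∑ p ∈ (Finset.range (⌊Y⌋₊ + 1)).filter Nat.Prime, bound := by
        refine Finset.sum_le_sum fun p hp => ?_
        obtain ⟨hpY, hp⟩ := Finset.mem_filter.1 hp
        have hpY' : (p : ℝ) ≤ Y :=
          (Nat.le_floor_iff (by positivity)).1 (Nat.lt_succ_iff.1 (Finset.mem_range.1 hpY))
        refine (card_unramifiedPoints_le_rpow g hg s (by exact_mod_cast (by omega : s ≠ 0)) p l U W
          hp hU).trans ?_
        rw [hgk]
        change _ ≤ (2 * l + k) * (Y ^ 2 * (T : ℝ) ^ θ)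
        gcongr
    _ ≤ (2 * Y) * bound := by
        rw [Finset.sum_const, nsmul_eq_mul]
        gcongr
        calc _ ≤ ((⌊Y⌋₊ + 1 : ℕ) : ℝ) := by
              exact_mod_cast (Finset.card_filter_le _ _).trans (by simp)
          _ ≤ 2 * Y := by push_cast; linarith [Nat.floor_le (show 0 ≤ Y by positivity)]
    _ ≤ (2 * Y) * ((2 * l + k) * (Y ^ 2 * (16 * (l + 1) ^ 2 * (W : ℝ) ^ (ε / 2) * √U))) := by
        rw [hbound]; gcongr
    _ = _ := by
        have : (W : ℝ) ^ ε = ((W : ℝ) ^ (ε / 6)) ^ 3 * (W : ℝ) ^ (ε / 2) := by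
          rw [← Real.rpow_natCast ((W : ℝ) ^ (ε / 6)), ← Real.rpow_mul (by positivity),
            ← Real.rpow_add (by positivity)]
          congr 1; push_cast; ring
        rw [hY, this]; ring

theorem irreducible_comp_linear (f : ℤ[X]) (hf : Irreducible (f.map (Int.castRingHom ℚ))) (s ν : ℤ)
    (hs : s ≠ 0) : Irreducible ((f.comp (C s * X + C ν)).map (Int.castRingHom ℚ)) := by
  have hs' : (s : ℚ) ≠ 0 := by exact_mod_cast hs
  let _ := invertibleOfNonzero hs'
  have h := (MulEquiv.irreducible_iff (algEquivCMulXAddC (s : ℚ) (ν : ℚ))).2 hf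
  rw [Polynomial.map_comp]
  rw [algEquivCMulXAddC_apply] at h
  convert h using 1
  simp [← comp_eq_aeval]

theorem natDegree_comp_linear (f : ℤ[X]) (s ν : ℤ) (hs : s ≠ 0) :
    (f.comp (C s * X + C ν)).natDegree = f.natDegree := by
  rw [natDegree_comp, natDegree_linear hs, mul_one]

theorem abs_eval_le_of_abs_coeff_le (f : ℤ[X]) (H N : ℕ) (hH : 1 ≤ H) (hf : f.natDegree ≠ 0)
    (hc : ∀ i, |f.coeff i| ≤ (H : ℤ)) (hN : 1 ≤ N) (x : ℤ) (hx : |x| ≤ 2 * N) :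
    |f.eval x| ≤ ((f.natDegree + 1) * (2 * (H * N)) ^ f.natDegree : ℕ) := by
  rw [eval_eq_sum_range]
  calc _ ≤ ∑ i ∈ Finset.range (f.natDegree + 1), |f.coeff i * x ^ i| :=
        Finset.abs_sum_le_sum_abs _ _
    _ ≤ ∑ _i ∈ Finset.range (f.natDegree + 1), ((2 * (H * N)) ^ f.natDegree : ℤ) := by
        refine Finset.sum_le_sum fun i hi => ?_
        have hi' : i ≤ f.natDegree := Nat.lt_succ_iff.1 (Finset.mem_range.1 hi)
        have hN' : (1 : ℤ) ≤ N := by exact_mod_cast hN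
        have hH' : (1 : ℤ) ≤ H := by exact_mod_cast hH
        rw [abs_mul, abs_pow]
        calc |f.coeff i| * |x| ^ i ≤ H * (2 * N) ^ i := by gcongr; exact hc i
          _ ≤ (H : ℤ) ^ f.natDegree * (2 * N) ^ f.natDegree := by
              gcongr
              · exact le_self_pow₀ hH' hf
              · linarith
          _ = _ := by rw [← mul_pow]; ring
    _ = _ := by simp

theorem sum_one_div_sqrt_le (S : ℕ) : ∑ s ∈ Finset.Icc 1 S, 1 / √(s : ℝ) ≤ 2 * √S := by
  induction S with
  | zero => simp
  | succ n ih =>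
    rw [Finset.sum_Icc_succ_top (by omega)]
    set a := √(n : ℝ) with ha
    set b := √((n + 1 : ℕ) : ℝ) with hb
    have ha2 : a ^ 2 = n := Real.sq_sqrt (by positivity)
    have hb2 : b ^ 2 = n + 1 := by rw [hb, Real.sq_sqrt (by positivity)]; push_cast; ring
    have ha0 : 0 ≤ a := Real.sqrt_nonneg _
    have hb0 : 0 < b := Real.sqrt_pos.2 (by positivity)
    have : 1 / b ≤ 2 * (b - a) := by
      rw [div_le_iff₀ hb0]
      nlinarith [sq_nonneg (b - a)]
    linarith

open Classical in
/-- The integers `1 ≤ n ≤ N` for which the square-free part of `f(n)` is at most `S`. -/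
noncomputable def smallSquarefreePart (f : ℤ[X]) (N S : ℕ) : Finset ℕ :=
  (Finset.Icc 1 N).filter fun n =>
    ∃ s ∈ Finset.Icc 1 S, Squarefree s ∧ ∃ r : ℤ, f.eval (n : ℤ) = s * r ^ 2

theorem mem_smallSquarefreePart {f : ℤ[X]} {N S n : ℕ} :
    n ∈ smallSquarefreePart f N S ↔ n ∈ Finset.Icc 1 N ∧
      ∃ s ∈ Finset.Icc 1 S, Squarefree s ∧ ∃ r : ℤ, f.eval (n : ℤ) = s * r ^ 2 := by
  simp only [smallSquarefreePart, Finset.mem_filter]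

theorem card_smallSquarefreePart_le (f : ℤ[X]) (N S : ℕ) :
    (smallSquarefreePart f N S).card ≤ N := by
  have h : smallSquarefreePart f N S ⊆ Finset.Icc 1 N :=
    fun _ hn => (mem_smallSquarefreePart.1 hn).1
  simpa using Finset.card_le_card h

theorem ncard_solutions_le (f : ℤ[X]) (hf : ∀ n : ℤ, f.eval n ≠ 0) (N S : ℕ) (D : ℝ)
    (hD : ∀ n : ℕ, n ≤ N → ((f.eval (n : ℤ)).natAbs.divisors.card : ℝ) ≤ D) :
    (Set.ncard {x : ℤ × ℤ × ℤ | 1 ≤ x.1 ∧ x.1 ≤ (N : ℤ) ∧ 1 ≤ x.2.2 ∧ x.2.2 ≤ (S : ℤ) ∧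
          f.eval x.1 = x.2.2 * x.2.1 ^ 2} : ℝ) ≤ (smallSquarefreePart f N S).card * (2 * D) := by
  classical
  set F : ℕ → Finset (ℤ × ℤ × ℤ) := fun n =>
    ((f.eval (n : ℤ)).natAbs.divisors ×ˢ ({1, -1} : Finset ℤ)).image
      fun d => ((n : ℤ), d.2 * d.1, f.eval (n : ℤ) / (d.1 : ℤ) ^ 2) with hF
  have hFcard : ∀ n ≤ N, ((F n).card : ℝ) ≤ 2 * D := by
    intro n hn
    have h1 : (F n).card ≤ (f.eval (n : ℤ)).natAbs.divisors.card * 2 := by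
      refine Finset.card_image_le.trans ?_
      rw [Finset.card_product]
      exact Nat.mul_le_mul_left _ Finset.card_le_two
    have h2 : ((F n).card : ℝ) ≤ (f.eval (n : ℤ)).natAbs.divisors.card * 2 := by exact_mod_cast h1
    linarith [hD n hn]
  have hsub : {x : ℤ × ℤ × ℤ | 1 ≤ x.1 ∧ x.1 ≤ (N : ℤ) ∧ 1 ≤ x.2.2 ∧ x.2.2 ≤ (S : ℤ) ∧
      f.eval x.1 = x.2.2 * x.2.1 ^ 2} ⊆ ↑((smallSquarefreePart f N S).biUnion F) := by
    rintro ⟨n, r, s⟩ ⟨hn1, hnN, hs1, hsS, h⟩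
    simp only at hn1 hnN hs1 hsS h
    lift n to ℕ using by omega
    lift s to ℕ using by omega
    have hr0 : r ≠ 0 := by
      rintro rfl
      exact hf n (by simpa using h)
    rw [Finset.mem_coe, Finset.mem_biUnion]
    refine ⟨n, ?_, ?_⟩
    · obtain ⟨a, b, hab, ha⟩ := Nat.sq_mul_squarefree s
      refine mem_smallSquarefreePart.2 ⟨Finset.mem_Icc.2 ⟨by omega, by omega⟩, a, ?_, ha, b * r, ?_⟩
      · have hb : b ≠ 0 := by rintro rfl; simp at hab; omega
        refine Finset.mem_Icc.2 ⟨Nat.one_le_iff_ne_zero.2 ha.ne_zero, ?_⟩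
        calc a ≤ b ^ 2 * a := Nat.le_mul_of_pos_left _ (by positivity)
          _ ≤ S := by rw [hab]; omega
      · rw [h, ← hab]; push_cast; ring
    · refine Finset.mem_image.2 ⟨(r.natAbs, r.sign), ?_, ?_⟩
      · rw [Finset.mem_product]
        constructor
        · refine Nat.mem_divisors.2 ⟨?_, Int.natAbs_ne_zero.2 (hf n)⟩
          exact Int.natAbs_dvd_natAbs.2 ⟨s * r, by rw [h]; ring⟩
        · rcases lt_or_gt_of_ne hr0 with h0 | h0
          · simp [Int.sign_eq_neg_one_of_neg h0]
          · simp [Int.sign_eq_one_of_pos h0]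
      · simp only [Int.sign_mul_natAbs, Int.natAbs_sq, h]
        rw [Int.mul_ediv_cancel _ (pow_ne_zero 2 hr0)]
  have h1 : Set.ncard {x : ℤ × ℤ × ℤ | 1 ≤ x.1 ∧ x.1 ≤ (N : ℤ) ∧ 1 ≤ x.2.2 ∧ x.2.2 ≤ (S : ℤ) ∧
      f.eval x.1 = x.2.2 * x.2.1 ^ 2} ≤ ((smallSquarefreePart f N S).biUnion F).card := by
    rw [← Set.ncard_coe_finset]
    exact Set.ncard_le_ncard hsub (Finset.finite_toSet _)
  calc _ ≤ ((((smallSquarefreePart f N S).biUnion F).card : ℕ) : ℝ) := by exact_mod_cast h1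
    _ ≤ ∑ n ∈ smallSquarefreePart f N S, ((F n).card : ℝ) := by
        exact_mod_cast Finset.card_biUnion_le
    _ ≤ ∑ n ∈ smallSquarefreePart f N S, 2 * D := Finset.sum_le_sum fun n hn =>
        hFcard n (Finset.mem_Icc.1 (mem_smallSquarefreePart.1 hn).1).2
    _ = _ := by rw [Finset.sum_const, nsmul_eq_mul]

open Classical in
theorem card_smallSquarefreePart_le_sum (f : ℤ[X]) (N S : ℕ) :
    (smallSquarefreePart f N S).card ≤ ∑ s ∈ (Finset.Icc 1 S).filter Squarefree,
      ∑ ν ∈ (Finset.range s).filter fun ν : ℕ => (s : ℤ) ∣ f.eval (ν : ℤ),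
        ((Finset.range (N / s + 1)).filter fun u : ℕ =>
          ∃ v : ℤ, (f.comp (C (s : ℤ) * X + C (ν : ℤ))).eval (u : ℤ) = s * v ^ 2).card := by
  have hsub : smallSquarefreePart f N S ⊆ ((Finset.Icc 1 S).filter Squarefree).biUnion fun s =>
      ((Finset.range s).filter fun ν : ℕ => (s : ℤ) ∣ f.eval (ν : ℤ)).biUnion fun ν =>
        ((Finset.range (N / s + 1)).filter fun u : ℕ =>
          ∃ v : ℤ, (f.comp (C (s : ℤ) * X + C (ν : ℤ))).eval (u : ℤ) = s * v ^ 2).image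
            fun u => s * u + ν := by
    intro n hn
    obtain ⟨hnN, s, hsS, hs, r, hr⟩ := mem_smallSquarefreePart.1 hn
    have hdm : s * (n / s) + n % s = n := Nat.div_add_mod n s
    have hdm' : (s : ℤ) * ((n / s : ℕ) : ℤ) + ((n % s : ℕ) : ℤ) = n := by exact_mod_cast hdm
    refine Finset.mem_biUnion.2 ⟨s, Finset.mem_filter.2 ⟨hsS, hs⟩, Finset.mem_biUnion.2
      ⟨n % s, Finset.mem_filter.2 ⟨Finset.mem_range.2 (Nat.mod_lt _ (Finset.mem_Icc.1 hsS).1), ?_⟩,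
        Finset.mem_image.2 ⟨n / s, Finset.mem_filter.2 ⟨?_, r, ?_⟩, hdm⟩⟩⟩
    · have h1 : (s : ℤ) ∣ f.eval (n : ℤ) := ⟨r ^ 2, hr⟩
      have h2 : (s : ℤ) ∣ f.eval (n : ℤ) - f.eval ((n % s : ℕ) : ℤ) :=
        dvd_trans ⟨((n / s : ℕ) : ℤ), by linarith⟩ (sub_dvd_eval_sub _ _ f)
      exact (dvd_sub_right h1).1 h2
    · exact Finset.mem_range.2 (Nat.lt_succ_iff.2 (Nat.div_le_div_right (Finset.mem_Icc.1 hnN).2))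
    · simp only [eval_comp, eval_add, eval_mul, eval_C, eval_X]
      rw [hdm', hr]
  refine (Finset.card_le_card hsub).trans (Finset.card_biUnion_le.trans ?_)
  refine Finset.sum_le_sum fun s _ => Finset.card_biUnion_le.trans ?_
  exact Finset.sum_le_sum fun ν _ => Finset.card_image_le

theorem exists_card_smallSquarefreePart_le (k : ℕ) (hk : 2 ≤ k) (ε : ℝ) (hε : 0 < ε) :
    ∃ C : ℝ, 1 ≤ C ∧ ∀ (f : ℤ[X]) (N S W : ℕ), f.natDegree = k →
      Irreducible (f.map (Int.castRingHom ℚ)) → f.content = 1 → S < N → N ≤ W →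
      (∀ x : ℤ, |x| ≤ 2 * N → |f.eval x| ≤ W) →
      ((smallSquarefreePart f N S).card : ℝ) ≤ C * (√N * √S) * (N : ℝ) ^ ε * (W : ℝ) ^ ε := by
  classical
  obtain ⟨A, hA, hroots⟩ := exists_card_roots_mod_squarefree_le k ε hε
  obtain ⟨B, hB, hpts⟩ := exists_card_eq_mul_sq_le k hk ε hε
  refine ⟨2 * A * B, by nlinarith, fun f N S W hfk hf hcont hSN hNW hW => ?_⟩
  have hterm : ∀ s ∈ (Finset.Icc 1 S).filter Squarefree,
      ((∑ ν ∈ (Finset.range s).filter fun ν : ℕ => (s : ℤ) ∣ f.eval (ν : ℤ),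
        ((Finset.range (N / s + 1)).filter fun u : ℕ =>
          ∃ v : ℤ, (f.comp (C (s : ℤ) * X + C (ν : ℤ))).eval (u : ℤ) = s * v ^ 2).card : ℕ) : ℝ)
        ≤ (A * B * √N * (N : ℝ) ^ ε * (W : ℝ) ^ ε) * (1 / √(s : ℝ)) := by
    intro s hs
    obtain ⟨hsS, hsq⟩ := Finset.mem_filter.1 hs
    obtain ⟨hs1, hsS⟩ := Finset.mem_Icc.1 hsS
    have hs0 : (s : ℤ) ≠ 0 := by omega
    rw [Nat.cast_sum]
    calc _ ≤ ∑ ν ∈ (Finset.range s).filter fun ν : ℕ => (s : ℤ) ∣ f.eval (ν : ℤ),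
          B * √((N / s : ℕ) : ℝ) * (W : ℝ) ^ ε := by
          refine Finset.sum_le_sum fun ν hν => ?_
          have hνs : ν < s := Finset.mem_range.1 (Finset.mem_filter.1 hν).1
          refine hpts _ s (N / s) W ((natDegree_comp_linear f s ν hs0).trans hfk)
            (irreducible_comp_linear f hf s ν hs0) hs1 ?_ (by omega) ?_
          · rw [Nat.one_le_div_iff (by omega)]; omega
          · intro u hu
            have h1 : s * u ≤ N := (Nat.mul_le_mul_left s hu).trans (Nat.mul_div_le N s)
            simp only [eval_comp, eval_add, eval_mul, eval_C, eval_X]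
            refine hW _ ?_
            rw [abs_of_nonneg (by positivity)]
            exact_mod_cast (by omega : s * u + ν ≤ 2 * N)
      _ ≤ (A * (s : ℝ) ^ ε) * (B * √((N / s : ℕ) : ℝ) * (W : ℝ) ^ ε) := by
          rw [Finset.sum_const, nsmul_eq_mul]
          gcongr
          exact hroots f hfk hcont s hsq
      _ ≤ (A * (N : ℝ) ^ ε) * (B * (√N / √(s : ℝ)) * (W : ℝ) ^ ε) := by
          gcongr
          · omega
          · rw [← Real.sqrt_div (by positivity)]
            exact Real.sqrt_le_sqrt Nat.cast_div_le
      _ = _ := by ring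
  have hle := (Nat.cast_le (α := ℝ)).2 (card_smallSquarefreePart_le_sum f N S)
  rw [Nat.cast_sum] at hle
  have hsum := Finset.sum_le_sum hterm
  calc ((smallSquarefreePart f N S).card : ℝ)
      ≤ ∑ s ∈ (Finset.Icc 1 S).filter Squarefree,
          (A * B * √N * (N : ℝ) ^ ε * (W : ℝ) ^ ε) * (1 / √(s : ℝ)) := by
        refine le_trans ?_ hsum
        convert hle
    _ ≤ ∑ s ∈ Finset.Icc 1 S, (A * B * √N * (N : ℝ) ^ ε * (W : ℝ) ^ ε) * (1 / √(s : ℝ)) :=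
        Finset.sum_le_sum_of_subset_of_nonneg (Finset.filter_subset _ _)
          fun _ _ _ => by positivity
    _ ≤ (A * B * √N * (N : ℝ) ^ ε * (W : ℝ) ^ ε) * (2 * √S) := by
        rw [← Finset.mul_sum]
        gcongr
        exact sum_one_div_sqrt_le S
    _ = _ := by ring

theorem squarefree_values_stmt16 (k : ℕ) (hk : 2 ≤ k) (ε : ℝ) (hε : 0 < ε) :
    ∃ C > 0, ∀ (f : Polynomial ℤ) (H N S : ℕ), 1 ≤ H → 1 ≤ N → 1 ≤ S →
      f.natDegree = k → Irreducible (f.map (Int.castRingHom ℚ)) → f.content = 1 →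
      (∀ i, |f.coeff i| ≤ (H : ℤ)) →
      (Set.ncard {x : ℤ × ℤ × ℤ | 1 ≤ x.1 ∧ x.1 ≤ (N : ℤ) ∧ 1 ≤ x.2.2 ∧ x.2.2 ≤ (S : ℤ) ∧
          f.eval x.1 = x.2.2 * x.2.1 ^ 2} : ℝ) ≤
        C * (Real.sqrt N * Real.sqrt S + S) * ((H : ℝ) * N) ^ ε := by
  have hk0 : (0 : ℝ) < k := by exact_mod_cast (by omega : 0 < k)
  have hk1 : (1 : ℝ) ≤ k := by exact_mod_cast (by omega : 1 ≤ k)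
  set η : ℝ := ε / (3 * k) with hη
  have hη0 : 0 < η := by positivity
  have hηk : k * η = ε / 3 := by rw [hη]; field_simp
  obtain ⟨A, hA, hdiv⟩ := exists_card_divisors_le_rpow η hη0
  obtain ⟨B, hB, hcount⟩ := exists_card_smallSquarefreePart_le k hk η hη0
  set c : ℝ := ((k + 1) * 2 ^ k : ℝ) ^ η with hc
  have hc1 : 1 ≤ c := by
    refine Real.one_le_rpow ?_ hη0.le
    have : (1 : ℝ) ≤ 2 ^ k := one_le_pow₀ (by norm_num)
    nlinarith
  refine ⟨2 * A * B * c ^ 2, by positivity, fun f H N S hH hN hS hfk hf hcont hcoeff => ?_⟩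
  set Y : ℝ := (H : ℝ) * N with hY
  have hN' : (1 : ℝ) ≤ N := by exact_mod_cast hN
  have hH' : (1 : ℝ) ≤ H := by exact_mod_cast hH
  have hY1 : 1 ≤ Y := one_le_mul_of_one_le_of_one_le hH' hN'
  set W : ℕ := (k + 1) * (2 * (H * N)) ^ k with hW
  have hfW : ∀ x : ℤ, |x| ≤ 2 * N → |f.eval x| ≤ W := by
    intro x hx
    have := abs_eval_le_of_abs_coeff_le f H N hH (by omega) hcoeff hN x hx
    rwa [hfk] at this
  have hWη : (W : ℝ) ^ η = c * Y ^ (ε / 3) := by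
    rw [hW, hc, ← hηk, Real.rpow_mul (by positivity), Real.rpow_natCast,
      ← Real.mul_rpow (by positivity) (by positivity), hY]
    congr 1; push_cast; rw [mul_pow]; ring
  have hNη : (N : ℝ) ^ η ≤ Y ^ (ε / 3) := by
    calc (N : ℝ) ^ η ≤ Y ^ η := by gcongr; rw [hY]; nlinarith
      _ ≤ Y ^ (ε / 3) := Real.rpow_le_rpow_of_exponent_le hY1 (by rw [← hηk]; nlinarith)
  have hYε : 1 ≤ Y ^ (ε / 3) := Real.one_le_rpow hY1 (by positivity)
  have hfne := eval_ne_zero_of_irreducible_map f hf (by omega)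
  have hmain := ncard_solutions_le f hfne N S (A * (c * Y ^ (ε / 3))) (by
    intro n hn
    refine (hdiv _ (Int.natAbs_ne_zero.2 (hfne n))).trans ?_
    rw [← hWη]
    gcongr
    have h1 := hfW n (by rw [Nat.abs_cast]; exact_mod_cast (by omega : n ≤ 2 * N))
    exact_mod_cast (Int.natCast_natAbs _).trans_le h1)
  have hcard : ((smallSquarefreePart f N S).card : ℝ) ≤
      B * c * (√N * √S + S) * (Y ^ (ε / 3)) ^ 2 := by
    rcases lt_or_ge S N with hSN | hNS
    · have hNW : N ≤ W := by
        calc N ≤ 2 * (H * N) := by nlinarith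
          _ ≤ (2 * (H * N)) ^ k := Nat.le_self_pow (by omega) _
          _ ≤ W := Nat.le_mul_of_pos_left _ (by omega)
      calc _ ≤ B * (√N * √S) * (N : ℝ) ^ η * (W : ℝ) ^ η :=
            hcount f N S W hfk hf hcont hSN hNW hfW
        _ ≤ B * (√N * √S + S) * Y ^ (ε / 3) * (c * Y ^ (ε / 3)) := by
            rw [hWη]
            gcongr
            linarith [(Nat.cast_nonneg S : (0 : ℝ) ≤ S)]
        _ = _ := by ring
    · have h1 : (smallSquarefreePart f N S).card ≤ S :=
        (card_smallSquarefreePart_le f N S).trans hNS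
      have h2 : (S : ℝ) ≤ √N * √S + S := by linarith [show 0 ≤ √(N : ℝ) * √S by positivity]
      calc ((smallSquarefreePart f N S).card : ℝ) ≤ 1 * 1 * (√N * √S + S) * 1 ^ 2 := by
            have : ((smallSquarefreePart f N S).card : ℝ) ≤ S := by exact_mod_cast h1
            linarith
        _ ≤ _ := by gcongr
  calc _ ≤ _ := hmain
    _ ≤ (B * c * (√N * √S + S) * (Y ^ (ε / 3)) ^ 2) * (2 * (A * (c * Y ^ (ε / 3)))) := by gcongr
    _ = _ := by
      have : Y ^ ε = (Y ^ (ε / 3)) ^ 3 := by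
        rw [← Real.rpow_natCast (Y ^ (ε / 3)), ← Real.rpow_mul (by positivity)]
        congr 1; push_cast; ring
      rw [this]; ring
end
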